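/- Let $n \geq 2$ and $p$ a prime, and let $S \subseteq \mathbb{Z}_p^n$ be a measurable set such that for every 2-dimensional subspace $U \in \mathrm{Gr}(\mathbb{Z}_p^n, 2)$ there exists a translate $a + U$ with $\mu_U(\{x \in U : a + x \in S\}) \geq \delta^2$ for some fixed $\delta \in (0,1]$. Then the Haar measure of $S$ satisfies $\mu(S) \geq C_n \delta^{2(n-1)}$ for a constant $C_n > 0$ depending only on $n$ and $p$. In particular (taking $\delta = 1$), any measurable set containing a translate of every 2-dimensional subspace of $\mathbb{Z}_p^n$ has positive Haar measure, i.e., $(n,2)$-Besicovitch sets do not exist in $\mathbb{Z}_p^n$. -/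

import Mathlib

open MeasureTheory ENNReal

noncomputable section

instance (p : ℕ) [Fact p.Prime] : MeasurableSpace ℤ_[p] := borel _
instance (p : ℕ) [Fact p.Prime] : BorelSpace ℤ_[p] := ⟨rfl⟩

/-- The Haar probability measure on `ℤ_p^n`. -/
def padicHaar (p : ℕ) [Fact p.Prime] (n : ℕ) : Measure (Fin n → ℤ_[p]) :=
  Measure.addHaarMeasure ⟨⟨Set.univ, isCompact_univ⟩, by simp⟩

/-- The Haar probability measure on the space of `2 × n` matrices over `ℤ_p`. -/
def matHaar (p : ℕ) [Fact p.Prime] (n : ℕ) : Measure (Fin 2 → Fin n → ℤ_[p]) :=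
  Measure.addHaarMeasure ⟨⟨Set.univ, isCompact_univ⟩, by simp⟩

/-- A `2 × n` matrix over `ℤ_p` has a unit `2 × 2` minor; its rows then span a rank-2
free direct summand of `ℤ_p^n`, i.e. an element of `Gr(ℤ_p^n, 2)`. -/
def unitMinor (p : ℕ) [Fact p.Prime] (n : ℕ) (g : Fin 2 → Fin n → ℤ_[p]) : Prop :=
  ∃ i j : Fin n, IsUnit (g 0 i * g 1 j - g 0 j * g 1 i)

/-- `Gr(ℤ_p^n, 2)`, parametrized by `2 × n` matrices with a unit `2 × 2` minor (the maps
below depend only on the submodule spanned by the rows). -/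
def grSet (p : ℕ) [Fact p.Prime] (n : ℕ) : Set (Fin 2 → Fin n → ℤ_[p]) :=
  {g | unitMinor p n g}

/-- The normalized measure `ν` on `Gr(ℤ_p^n, 2)` induced by Haar measure: the normalized
restriction of Haar measure on matrix space to matrices with a unit `2 × 2` minor. -/
def grMeasure (p : ℕ) [Fact p.Prime] (n : ℕ) : Measure (Fin 2 → Fin n → ℤ_[p]) :=
  (matHaar p n (grSet p n))⁻¹ • (matHaar p n).restrict (grSet p n)

/-- The maximal 2-plane operator: `𝒩² f (U) = sup_a ∫_{x ∈ U} f(a + x) dμ_U`, where the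
2-plane `U` is spanned by the rows of `g` and `μ_U` is its Haar probability measure,
parametrized by `(s₀, s₁) ↦ s₀ g₀ + s₁ g₁`. -/
def maxOp2 (p : ℕ) [Fact p.Prime] (n : ℕ) (f : (Fin n → ℤ_[p]) → ℝ≥0∞)
    (g : Fin 2 → Fin n → ℤ_[p]) : ℝ≥0∞ :=
  ⨆ a : Fin n → ℤ_[p],
    ∫⁻ s : Fin 2 → ℤ_[p], f (fun j => a j + s 0 * g 0 j + s 1 * g 1 j) ∂(padicHaar p 2)

open Polynomial in
theorem exists_pow_sub_pow_eq (p : ℕ) [Fact p.Prime] (k : Type*) [Field k] [CharP k p]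
    {b b' : ℕ} (hb : b ≠ b') :
    ∃ u : k[X], u.eval 1 ≠ 0 ∧
      (X : k[X]) ^ b - X ^ b' = (X - C 1) ^ p ^ padicValNat p (Nat.dist b b') * u := by
  have key : ∀ r : ℕ, r ≠ 0 → ∃ u : k[X], u.eval 1 ≠ 0 ∧
      (X : k[X]) ^ r - 1 = (X - C 1) ^ p ^ padicValNat p r * u := by
    intro r hr
    set v := padicValNat p r with hvdef
    obtain ⟨t, ht⟩ : p ^ v ∣ r := pow_padicValNat_dvd
    have hpt : ¬ p ∣ t := by
      rintro ⟨w, hw⟩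
      apply pow_succ_padicValNat_not_dvd (p := p) hr
      rw [← hvdef]
      exact ⟨w, by rw [ht, hw]; ring⟩
    refine ⟨(∑ i ∈ Finset.range t, X ^ i) ^ p ^ v, ?_, ?_⟩
    · simp only [eval_pow, eval_finsetSum, eval_X, one_pow, Finset.sum_const, Finset.card_range,
        nsmul_eq_mul, mul_one]
      exact pow_ne_zero _ (by rwa [Ne, CharP.cast_eq_zero_iff k p])
    · have h1 : (X - C 1 : k[X]) * ∑ i ∈ Finset.range t, X ^ i = X ^ t - 1 := by
        simpa using mul_geom_sum (X : k[X]) t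
      rw [← mul_pow, h1, sub_pow_char_pow, one_pow, ← pow_mul, mul_comm t, ← ht]
  rcases lt_or_gt_of_ne hb with h | h
  · obtain ⟨u, hu, hX⟩ := key (b' - b) (by omega)
    refine ⟨-(X ^ b * u), by simpa using hu, ?_⟩
    rw [Nat.dist_eq_sub_of_le h.le]
    have : (X : k[X]) ^ b' = X ^ b * X ^ (b' - b) := by rw [← pow_add]; congr 1; omega
    rw [this]
    linear_combination (-(X : k[X]) ^ b) * hX
  · obtain ⟨u, hu, hX⟩ := key (b - b') (by omega)
    refine ⟨X ^ b' * u, by simpa using hu, ?_⟩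
    rw [Nat.dist_comm, Nat.dist_eq_sub_of_le h.le]
    have : (X : k[X]) ^ b = X ^ b' * X ^ (b - b') := by rw [← pow_add]; congr 1; omega
    rw [this]
    linear_combination ((X : k[X]) ^ b') * hX

theorem sum_pow_padicValNat_le (p : ℕ) [Fact p.Prime] {k b : ℕ} (hb : b < p ^ k) :
    ∑ r ∈ Finset.Ioc 0 b, p ^ padicValNat p r ≤ b * k := by
  calc ∑ r ∈ Finset.Ioc 0 b, p ^ padicValNat p r
      ≤ ∑ r ∈ Finset.Ioc 0 b, ∑ j ∈ Finset.range k, if p ^ j ∣ r then p ^ j else 0 := by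
        refine Finset.sum_le_sum fun r hr => ?_
        rw [Finset.mem_Ioc] at hr
        have hlt : padicValNat p r < k := by
          by_contra! h
          have h1 : p ^ k ∣ r := (pow_dvd_pow p h).trans pow_padicValNat_dvd
          exact absurd (Nat.le_of_dvd hr.1 h1) (by omega)
        refine le_trans ?_ (Finset.single_le_sum (fun _ _ => Nat.zero_le _)
          (Finset.mem_range.2 hlt))
        rw [if_pos pow_padicValNat_dvd]
    _ = ∑ j ∈ Finset.range k, (b / p ^ j) * p ^ j := by
        rw [Finset.sum_comm]
        refine Finset.sum_congr rfl fun j _ => ?_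
        rw [← Finset.sum_filter, Finset.sum_const, Nat.Ioc_filter_dvd_card_eq_div, smul_eq_mul]
    _ ≤ ∑ j ∈ Finset.range k, b := Finset.sum_le_sum fun j _ => Nat.div_mul_le_self _ _
    _ = b * k := by simp [mul_comm]

theorem sum_erase_pow_padicValNat_dist_le (p : ℕ) [hp : Fact p.Prime] {k b D : ℕ}
    (hb : b ≤ D) (hD : D < p ^ k) :
    ∑ b' ∈ (Finset.range (D + 1)).erase b, p ^ padicValNat p (Nat.dist b b') ≤ D * k := by
  have hsplit : (Finset.range (D + 1)).erase b ⊆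
      ((Finset.Ioc 0 b).image fun r => b - r) ∪ ((Finset.Ioc 0 (D - b)).image fun r => b + r) := by
    intro i hi
    simp only [Finset.mem_erase, Finset.mem_range, Finset.mem_union, Finset.mem_image,
      Finset.mem_Ioc] at hi ⊢
    rcases lt_or_gt_of_ne hi.1 with h | h
    · exact Or.inl ⟨b - i, by omega, by omega⟩
    · exact Or.inr ⟨i - b, by omega, by omega⟩
  calc _ ≤ _ := Finset.sum_le_sum_of_subset hsplit
    _ ≤ ∑ b' ∈ (Finset.Ioc 0 b).image fun r => b - r, p ^ padicValNat p (Nat.dist b b')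
        + ∑ b' ∈ (Finset.Ioc 0 (D - b)).image fun r => b + r,
            p ^ padicValNat p (Nat.dist b b') := by
        rw [← Finset.sum_union_inter]; exact Nat.le_add_right _ _
    _ = ∑ r ∈ Finset.Ioc 0 b, p ^ padicValNat p r
        + ∑ r ∈ Finset.Ioc 0 (D - b), p ^ padicValNat p r := by
        rw [Finset.sum_image, Finset.sum_image]
        · congr 1
          · refine Finset.sum_congr rfl fun r hr => ?_
            rw [Finset.mem_Ioc] at hr
            congr 2; unfold Nat.dist; omega
          · refine Finset.sum_congr rfl fun r hr => ?_
            congr 2; unfold Nat.dist; omega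
        · intro x _ y _ h; simpa using h
        · intro x hx y hy h
          simp only [Finset.coe_Ioc, Set.mem_Ioc] at hx hy h; omega
    _ ≤ b * k + (D - b) * k := add_le_add (sum_pow_padicValNat_le p (by omega))
        (sum_pow_padicValNat_le p (by omega))
    _ = D * k := by rw [← add_mul]; congr 1; omega

open Polynomial in
/-- Lagrange interpolation at the nodes `1, X, …, X ^ D`, tracking powers of `X - 1`. -/
theorem X_sub_one_pow_dvd_coeff (p : ℕ) [hp : Fact p.Prime] (k : Type*) [Field k] [CharP k p]
    {κ D N : ℕ} (hD : D < p ^ κ) (c : Fin (D + 1) → k[X])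
    (h : ∀ b : Fin (D + 1), (X - C 1) ^ N ∣ ∑ j, c j * X ^ ((b : ℕ) * j)) (j : Fin (D + 1)) :
    (X - C 1) ^ (N - D * κ) ∣ c j := by
  classical
  rcases le_or_gt N (D * κ) with hN | hN
  · simp [Nat.sub_eq_zero_of_le hN]
  have hu' : ∀ b b' : ℕ, ∃ u : k[X], u.eval 1 ≠ 0 ∧ (b ≠ b' →
      (X : k[X]) ^ b - X ^ b' = (X - C 1) ^ p ^ padicValNat p (Nat.dist b b') * u) := by
    intro b b'
    by_cases hb : b = b'
    · exact ⟨1, by simp, fun h => absurd hb h⟩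
    · obtain ⟨u, hu, h⟩ := exists_pow_sub_pow_eq p k hb
      exact ⟨u, hu, fun _ => h⟩
  choose u hu huX using hu'
  set s := Finset.range (D + 1) with hs
  let U : ℕ → k[X] := fun b => ∏ b' ∈ s.erase b, u b b'
  let e : ℕ → ℕ := fun b => ∑ b' ∈ s.erase b, p ^ padicValNat p (Nat.dist b b')
  have he : ∀ b ∈ s, e b ≤ D * κ := fun b hb =>
    sum_erase_pow_padicValNat_dist_le p (by simpa [hs, Nat.lt_succ_iff] using hb) hD
  have hprod : ∀ b ∈ s, ∏ b' ∈ s.erase b, ((X : k[X]) ^ b - X ^ b') = (X - C 1) ^ e b * U b := by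
    intro b _
    rw [← Finset.prod_pow_eq_pow_sum, ← Finset.prod_mul_distrib]
    exact Finset.prod_congr rfl fun b' hb' => huX b b' (Finset.ne_of_mem_erase hb').symm
  let F : k[X][X] := ∑ j : Fin (D + 1), C (c j) * X ^ (j : ℕ)
  have hFeval : ∀ b : ℕ, F.eval (X ^ b) = ∑ j, c j * X ^ (b * (j : ℕ)) := by
    intro b; simp [F, eval_finsetSum, ← pow_mul]
  let W : k[X] := (X - C 1) ^ (D * κ) * ∏ b ∈ s, U b
  let V : ℕ → k[X] := fun b => (X - C 1) ^ (D * κ - e b) * ∏ b' ∈ s.erase b, U b'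
  let G : k[X][X] := ∑ b ∈ s, C (V b * F.eval (X ^ b)) * ∏ b' ∈ s.erase b, (X - C (X ^ b'))
  have hinj : Function.Injective fun b : ℕ => (X : k[X]) ^ b := by
    intro a b hab
    simpa using congrArg natDegree hab
  have hFdeg : (C W * F).degree < (s.image fun b : ℕ => (X : k[X]) ^ b).card := by
    rw [Finset.card_image_of_injective _ hinj, hs, Finset.card_range]
    rw [← smul_eq_C_mul]
    refine lt_of_le_of_lt (degree_smul_le _ _) ?_
    refine lt_of_le_of_lt (degree_sum_le _ _) ?_
    rw [Finset.sup_lt_iff (by exact WithBot.bot_lt_coe _)]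
    intro j _
    refine lt_of_le_of_lt (degree_C_mul_X_pow_le _ _) ?_
    exact_mod_cast j.2
  have hGdeg : G.degree < (s.image fun b : ℕ => (X : k[X]) ^ b).card := by
    rw [Finset.card_image_of_injective _ hinj, hs, Finset.card_range]
    refine lt_of_le_of_lt (degree_sum_le _ _) ?_
    rw [Finset.sup_lt_iff (by exact WithBot.bot_lt_coe _)]
    intro b hb
    rw [← smul_eq_C_mul]
    refine lt_of_le_of_lt (degree_smul_le _ _) ?_
    rw [degree_prod]
    have hcard : (s.erase b).card = D := by rw [Finset.card_erase_of_mem hb, hs]; simp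
    simp only [degree_X_sub_C, Finset.sum_const, hcard, nsmul_eq_mul, mul_one]
    exact_mod_cast Nat.lt_succ_self D
  have hFG : C W * F = G := by
    refine eq_of_degrees_lt_of_eval_finset_eq _ hFdeg hGdeg ?_
    intro x hx
    obtain ⟨b, hb, rfl⟩ := Finset.mem_image.1 hx
    rw [eval_mul, eval_C, show G.eval (X ^ b) = _ from eval_finsetSum _ _ _,
      Finset.sum_eq_single b]
    · rw [eval_mul, eval_C, eval_prod]
      simp only [eval_sub, eval_X, eval_C]
      rw [hprod b hb]
      simp only [W, V]
      rw [← Finset.mul_prod_erase s U hb]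
      rw [show (X - C 1 : k[X]) ^ (D * κ) = (X - C 1) ^ (D * κ - e b) * (X - C 1) ^ e b by
        rw [← pow_add]; congr 1; have := he b hb; omega]
      ring
    · intro b' hb' hne
      rw [eval_mul, eval_prod, Finset.prod_eq_zero (i := b), mul_zero]
      · exact Finset.mem_erase.2 ⟨hne.symm, hb⟩
      · simp
    · exact fun h => absurd hb h
  have hcoeff : F.coeff j = c j := by
    simp only [F, finsetSum_coeff, coeff_C_mul, coeff_X_pow]
    rw [Finset.sum_eq_single j]
    · simp
    · intro i _ hi
      rw [if_neg (by intro h; exact hi (Fin.ext h.symm)), mul_zero]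
    · simp
  have hdvd : (X - C 1 : k[X]) ^ N ∣ W * c j := by
    rw [← hcoeff, ← coeff_C_mul, hFG]
    simp only [G, finsetSum_coeff, coeff_C_mul]
    refine Finset.dvd_sum fun b hb => Dvd.dvd.mul_right (Dvd.dvd.mul_left ?_ _) _
    rw [hFeval]
    exact h ⟨b, by simpa [hs] using hb⟩
  have hNs : (X - C 1 : k[X]) ^ N = (X - C 1) ^ (D * κ) * (X - C 1) ^ (N - D * κ) := by
    rw [← pow_add]; congr 1; omega
  simp only [W] at hdvd
  rw [hNs, mul_assoc] at hdvd
  have hdvd' := (mul_dvd_mul_iff_left (pow_ne_zero _ (X_sub_C_ne_zero (1 : k)))).1 hdvd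
  refine (prime_X_sub_C (1 : k)).pow_dvd_of_dvd_mul_left _ ?_ hdvd'
  rw [dvd_iff_isRoot, IsRoot.def, eval_prod, Finset.prod_eq_zero_iff]
  rintro ⟨b, _, hb0⟩
  rw [eval_prod, Finset.prod_eq_zero_iff] at hb0
  obtain ⟨b', _, hb0⟩ := hb0
  exact hu b b' hb0

open Polynomial in
theorem X_sub_one_pow_dvd_coeff_multi (p : ℕ) [hp : Fact p.Prime] (k : Type*) [Field k]
    [CharP k p] {κ D : ℕ} (hD : D < p ^ κ) (m : ℕ) :
    ∀ (N : ℕ) (c : (Fin m → Fin (D + 1)) → k[X]),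
    (∀ b : Fin m → Fin (D + 1), (X - C 1) ^ N ∣ ∑ v, c v * X ^ ∑ i, (b i : ℕ) * v i) →
    ∀ v, (X - C 1) ^ (N - m * (D * κ)) ∣ c v := by
  induction m with
  | zero =>
    intro N c h v
    have h0 := h v
    rw [Fintype.sum_subsingleton _ v] at h0
    simpa using h0
  | succ m ih =>
    intro N c h v
    have h1 : ∀ (b : Fin m → Fin (D + 1)) (j : Fin (D + 1)), (X - C 1) ^ (N - D * κ) ∣
        ∑ w : Fin m → Fin (D + 1), c (Fin.cons j w) * X ^ ∑ i, (b i : ℕ) * w i := by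
      intro b
      refine X_sub_one_pow_dvd_coeff p k hD _ fun b0 => ?_
      convert h (Fin.cons b0 b) using 1
      rw [← (Fin.consEquiv fun _ : Fin (m + 1) => Fin (D + 1)).sum_comp, Fintype.sum_prod_type]
      refine Finset.sum_congr rfl fun j _ => ?_
      rw [Finset.sum_mul]
      refine Finset.sum_congr rfl fun w _ => ?_
      change _ = c (Fin.cons j w) * X ^ ∑ i, ((Fin.cons b0 b : Fin (m + 1) → Fin (D + 1)) i : ℕ) *
        ((Fin.cons j w : Fin (m + 1) → Fin (D + 1)) i : ℕ)
      simp only [Fin.sum_univ_succ, Fin.cons_zero, Fin.cons_succ]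
      rw [pow_add]; ring
    have h2 := ih (N - D * κ) (fun w => c (Fin.cons (v 0) w)) (fun b => h1 b (v 0)) (Fin.tail v)
    rw [Fin.cons_self_tail] at h2
    convert h2 using 2
    rw [Nat.sub_sub]; congr 1; ring

open Polynomial in
/-- A polynomial with exponents in a box, vanishing to high order at `1` along all curves
`z ↦ (z, z ^ b)`, is zero. -/
theorem eq_zero_of_X_sub_one_pow_dvd (p : ℕ) [hp : Fact p.Prime] (k : Type*) [Field k]
    [CharP k p] {κ D M N m : ℕ} (hD : D < p ^ κ) (hN : M + m * (D * κ) ≤ N)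
    (c : Fin M × (Fin m → Fin (D + 1)) → k)
    (h : ∀ b : Fin m → Fin (D + 1),
      (X - C 1) ^ N ∣ ∑ v, C (c v) * X ^ ((v.1 : ℕ) + ∑ i, (b i : ℕ) * v.2 i)) : c = 0 := by
  have h1 := X_sub_one_pow_dvd_coeff_multi p k hD m N
    (fun w => ∑ i : Fin M, C (c (i, w)) * X ^ (i : ℕ)) (fun b => by
      convert h b using 1
      rw [Fintype.sum_prod_type_right]
      refine Finset.sum_congr rfl fun w _ => ?_
      rw [Finset.sum_mul]
      refine Finset.sum_congr rfl fun i _ => ?_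
      rw [pow_add]; ring)
  funext ⟨i, w⟩
  have h2 := (pow_dvd_pow (X - C 1 : k[X]) (show M ≤ N - m * (D * κ) by omega)).trans (h1 w)
  have h3 : ∑ i : Fin M, C (c (i, w)) * X ^ (i : ℕ) = 0 := by
    refine eq_zero_of_dvd_of_degree_lt h2 ?_
    rw [degree_pow, degree_X_sub_C]
    refine lt_of_le_of_lt (degree_sum_le _ _) ?_
    rw [Finset.sup_lt_iff (by simp)]
    intro i _
    refine lt_of_le_of_lt (degree_C_mul_X_pow_le _ _) ?_
    simp
  have h4 := congrArg (fun P => coeff P i) h3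
  simp only [finsetSum_coeff, coeff_C_mul, coeff_X_pow, coeff_zero] at h4
  rw [Finset.sum_eq_single i] at h4
  · simpa using h4
  · intro j _ hj
    rw [if_neg (by intro h; exact hj (Fin.ext h.symm)), mul_zero]
  · simp

/-- A valuation ring of residue characteristic `p` with a primitive `q`-th root of unity. -/
theorem exists_valuationRing_primitiveRoot (p : ℕ) [hp : Fact p.Prime] (q : ℕ) (hq : q ≠ 0) :
    ∃ (O : Type) (_ : CommRing O) (_ : IsDomain O) (_ : ValuationRing O)
      (_ : CharP (IsLocalRing.ResidueField O) p) (ζ : O), IsPrimitiveRoot ζ q := by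
  let O := (Valued.v : Valuation (PadicAlgCl p) NNReal).valuationSubring
  have : NeZero ((q : ℕ) : PadicAlgCl p) := ⟨by exact_mod_cast hq⟩
  obtain ⟨ζ, hζ⟩ := HasEnoughRootsOfUnity.exists_primitiveRoot (PadicAlgCl p) q
  have hmem : ζ ∈ O := by
    rw [Valuation.mem_valuationSubring_iff]
    have : (Valued.v ζ : NNReal) ^ q = 1 := by rw [← map_pow, hζ.pow_eq_one, map_one]
    exact ((pow_eq_one_iff_of_nonneg (by positivity) hq).1 this).le
  refine ⟨O, inferInstance, inferInstance, inferInstance, ?_, ⟨ζ, hmem⟩, ?_⟩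
  · have h0 : ((p : ℕ) : IsLocalRing.ResidueField O) = 0 := by
      rw [← map_natCast (IsLocalRing.residue O), IsLocalRing.residue_eq_zero_iff,
        IsLocalRing.mem_maximalIdeal, mem_nonunits_iff]
      rintro ⟨⟨x, y, hxy, _⟩, hx⟩
      simp only at hx
      rw [hx] at hxy
      have h1 : ((p : ℕ) : PadicAlgCl p) * y = 1 := by
        simpa using congrArg (Subtype.val) hxy
      have h2 := congrArg (Valued.v : PadicAlgCl p → NNReal) h1
      rw [map_mul, map_one, PadicAlgCl.valuation_p] at h2
      have h3 : Valued.v (y : PadicAlgCl p) ≤ (1 : NNReal) :=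
        (Valuation.mem_valuationSubring_iff _ _).1 y.2
      have h4 : (1 : NNReal) < p := by exact_mod_cast hp.out.one_lt
      have h5 : (1 : NNReal) / p < 1 := by rw [div_lt_one (by positivity)]; exact h4
      have := mul_lt_mul_of_lt_of_le_of_nonneg_of_pos h5 h3 (by positivity) one_pos
      rw [h2] at this
      simp at this
    exact (CharP.charP_iff_prime_eq_zero hp.out).2 h0
  · exact IsPrimitiveRoot.of_map_of_injective (f := O.subtype) (by simpa using hζ)
      Subtype.val_injective

theorem ValuationRing.exists_forall_dvd {O ι : Type*} [CommRing O] [IsDomain O] [ValuationRing O]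
    (s : Finset ι) (hs : s.Nonempty) (c : ι → O) : ∃ i ∈ s, ∀ j ∈ s, c i ∣ c j := by
  classical
  induction hs using Finset.Nonempty.cons_induction with
  | singleton a => exact ⟨a, by simp⟩
  | cons a s ha hs ih =>
    obtain ⟨i, hi, hij⟩ := ih
    rcases ValuationRing.dvd_total (c a) (c i) with h | h
    · refine ⟨a, by simp, fun j hj => ?_⟩
      rcases Finset.mem_cons.1 hj with rfl | hj
      · exact dvd_rfl
      · exact h.trans (hij j hj)
    · refine ⟨i, by simp [hi], fun j hj => ?_⟩
      rcases Finset.mem_cons.1 hj with rfl | hj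
      · exact h
      · exact hij j hj

open Polynomial in
/-- The Kakeya (Furstenberg) estimate over `ℤ/p^κ`, with lines in every direction `(1, b)`. -/
theorem card_ge_of_lines (p : ℕ) [hp : Fact p.Prime] {κ m D M N : ℕ} (hD : D < p ^ κ)
    (hN : M + m * (D * κ) ≤ N) (E : Finset (ZMod (p ^ κ) × (Fin m → ZMod (p ^ κ))))
    (h : ∀ b : Fin m → ZMod (p ^ κ), ∃ a : ZMod (p ^ κ) × (Fin m → ZMod (p ^ κ)),
      N ≤ (Finset.univ.filter fun t : ZMod (p ^ κ) => a + t • (1, b) ∈ E).card) :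
    M * (D + 1) ^ m ≤ E.card := by
  classical
  by_contra! hlt
  have hq : p ^ κ ≠ 0 := pow_ne_zero _ hp.out.ne_zero
  obtain ⟨O, _, _, _, _, ζ, hζ⟩ := exists_valuationRing_primitiveRoot p (p ^ κ) hq
  let ψ : AddChar (ZMod (p ^ κ)) O := AddChar.zmodChar (p ^ κ) hζ.pow_eq_one
  have hψinj : Function.Injective ψ := by
    intro x y hxy
    simp only [ψ, AddChar.zmodChar_apply] at hxy
    exact ZMod.val_injective _ (hζ.pow_inj (ZMod.val_lt x) (ZMod.val_lt y) hxy)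
  let V := Fin M × (Fin m → Fin (D + 1))
  let ℓ : V → ZMod (p ^ κ) × (Fin m → ZMod (p ^ κ)) → ZMod (p ^ κ) := fun v x =>
    ((v.1 : ℕ) : ZMod (p ^ κ)) * x.1 + ∑ i, ((v.2 i : ℕ) : ZMod (p ^ κ)) * x.2 i
  let A : Matrix E V O := fun x v => ψ (ℓ v x)
  have hninj : ¬ Function.Injective (Matrix.toLin' A) := by
    intro hinj
    have := card_le_of_injective O (Matrix.toLin' A) hinj
    simp only [V, Fintype.card_prod, Fintype.card_fin, Fintype.card_pi, Finset.prod_const,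
      Finset.card_univ, Fintype.card_coe] at this
    omega
  obtain ⟨c, hc, hc0⟩ : ∃ c : V → O, Matrix.toLin' A c = 0 ∧ c ≠ 0 := by
    by_contra! hcon
    exact hninj ((injective_iff_map_eq_zero _).2 hcon)
  obtain ⟨v1, hv1⟩ : ∃ v, c v ≠ 0 := by
    by_contra! hcon; exact hc0 (funext hcon)
  obtain ⟨v0, -, hv0⟩ := ValuationRing.exists_forall_dvd Finset.univ ⟨v1, Finset.mem_univ _⟩ c
  have hcv0 : c v0 ≠ 0 := by
    intro h0
    exact hv1 (zero_dvd_iff.1 (h0 ▸ hv0 v1 (Finset.mem_univ _)))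
  choose c' hc' using fun v => hv0 v (Finset.mem_univ v)
  have hc'0 : c' v0 = 1 := by
    have := hc' v0
    exact mul_left_cancel₀ hcv0 (by rw [← this, mul_one])
  have hvan : ∀ x ∈ E, ∑ v, c' v * ψ (ℓ v x) = 0 := by
    intro x hx
    have h1 := congrFun hc ⟨x, hx⟩
    simp only [A, Pi.zero_apply] at h1
    refine (mul_eq_zero.1 (?_ : c v0 * _ = 0)).resolve_left hcv0
    rw [← h1, Finset.mul_sum]
    refine Finset.sum_congr rfl fun v _ => ?_
    conv_rhs => rw [hc' v]
    ring
  let res := IsLocalRing.residue O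
  have hres : ∀ t, res (ψ t) = 1 := by
    intro t
    have h1 : (ψ t) ^ (p ^ κ) = 1 := by
      simp only [ψ, AddChar.zmodChar_apply]
      rw [← pow_mul, mul_comm, pow_mul, hζ.pow_eq_one, one_pow]
    have h2 : (res (ψ t) - 1) ^ (p ^ κ) = 0 := by
      rw [sub_pow_char_pow, one_pow, ← map_pow, h1, map_one, sub_self]
    exact sub_eq_zero.1 (pow_eq_zero_iff hq |>.1 h2)
  have hzero := eq_zero_of_X_sub_one_pow_dvd p (IsLocalRing.ResidueField O) hD hN
    (fun v : V => res (c' v)) (by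
      intro b
      obtain ⟨a, ha⟩ := h fun i => ((b i : ℕ) : ZMod (p ^ κ))
      set T := Finset.univ.filter fun t : ZMod (p ^ κ) =>
        a + t • ((1 : ZMod (p ^ κ)), fun i => ((b i : ℕ) : ZMod (p ^ κ))) ∈ E with hT
      let g : O[X] := ∑ v : V, C (c' v * ψ (ℓ v a)) * X ^ ((v.1 : ℕ) + ∑ i, (b i : ℕ) * v.2 i)
      have hroot : ∀ t ∈ T, g.eval (ψ t) = 0 := by
        intro t ht
        rw [hT, Finset.mem_filter] at ht
        have h1 := hvan _ ht.2
        simp only [g, eval_finsetSum, eval_mul, eval_C, eval_pow, eval_X]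
        rw [← h1]
        refine Finset.sum_congr rfl fun v _ => ?_
        rw [mul_assoc, ← AddChar.map_nsmul_eq_pow, ← AddChar.map_add_eq_mul]
        congr 2
        simp only [ℓ, Prod.fst_add, Prod.snd_add, Prod.smul_fst, Prod.smul_snd, smul_eq_mul,
          mul_one, Pi.add_apply, Pi.smul_apply, mul_add, Finset.sum_add_distrib, nsmul_eq_mul,
          Nat.cast_add, Nat.cast_sum, Nat.cast_mul, add_mul, Finset.sum_mul]
        have : ∀ i, ((v.2 i : ℕ) : ZMod (p ^ κ)) * (t * ((b i : ℕ) : ZMod (p ^ κ))) =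
          ((b i : ℕ) : ZMod (p ^ κ)) * ((v.2 i : ℕ) : ZMod (p ^ κ)) * t := fun i => by ring
        simp only [this]
        ring
      have hdvd : ∏ t ∈ T, (X - C (ψ t)) ∣ g := by
        by_cases hg : g = 0
        · rw [hg]; exact dvd_zero _
        have : (∏ t ∈ T, (X - C (ψ t))) = ((T.val.map ψ).map fun a => X - C a).prod := by
          rw [Multiset.map_map]; rfl
        rw [this, Multiset.prod_X_sub_C_dvd_iff_le_roots hg,
          Multiset.le_iff_subset (T.nodup.map hψinj)]
        intro x hx
        obtain ⟨t, ht, rfl⟩ := Multiset.mem_map.1 hx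
        exact (mem_roots hg).2 (hroot t ht)
      have hmap := map_dvd (mapRingHom res) hdvd
      simp only [g, map_prod, map_sum, map_sub, map_mul, map_pow, coe_mapRingHom, map_X, map_C,
        hres, Finset.prod_const] at hmap
      simp only [map_one, mul_one] at hmap
      exact (pow_dvd_pow _ ha).trans hmap)
  have := congrFun hzero v0
  simp [hc'0] at this

/-- Random translates of a set of density `β` cover a finite group up to a proportion
`(1 - β) ^ N`. -/
theorem exists_translates_card_compl_le {G : Type*} [AddCommGroup G] [Fintype G] [DecidableEq G]
    (B : Finset G) (N : ℕ) : ∃ T : Finset G, T.card ≤ N ∧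
      ((Finset.univ.filter fun x : G => ∀ t ∈ T, x - t ∉ B).card : ℝ) ≤
        Fintype.card G * (1 - B.card / Fintype.card G : ℝ) ^ N := by
  have hG : (0 : ℝ) < Fintype.card G := by exact_mod_cast Fintype.card_pos
  induction N with
  | zero => exact ⟨∅, by simp⟩
  | succ N ih =>
    obtain ⟨T, hT, hX⟩ := ih
    set Y := Finset.univ.filter fun x : G => ∀ t ∈ T, x - t ∉ B with hY
    have hsum : ∑ t : G, ((Y.filter fun x => x - t ∈ B).card : ℝ) = Y.card * B.card := by
      simp only [Finset.card_filter, Nat.cast_sum]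
      rw [Finset.sum_comm]
      have : ∀ x ∈ Y, ∑ t : G, (((if x - t ∈ B then 1 else 0 : ℕ)) : ℝ) = B.card := by
        intro x _
        rw [← Nat.cast_sum, ← Finset.card_filter]
        congr 1
        refine Finset.card_nbij' (fun t => x - t) (fun t => x - t) ?_ ?_ ?_ ?_
        · intro t ht; simpa using ht
        · intro t ht; simpa using ht
        · intro t _; simp
        · intro t _; simp
      rw [Finset.sum_congr rfl this, Finset.sum_const, nsmul_eq_mul]
    obtain ⟨t, -, ht⟩ := Finset.exists_le_of_sum_le (s := (Finset.univ : Finset G))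
      (f := fun _ => (Y.card * B.card / Fintype.card G : ℝ))
      (g := fun t => ((Y.filter fun x => x - t ∈ B).card : ℝ)) ⟨0, Finset.mem_univ _⟩ (by
        rw [hsum, Finset.sum_const, nsmul_eq_mul, Finset.card_univ]
        field_simp; rfl)
    refine ⟨insert t T, (Finset.card_insert_le _ _).trans (by omega), ?_⟩
    have hsplit : (Y.filter fun x => x - t ∈ B).card +
        (Finset.univ.filter fun x : G => ∀ t' ∈ insert t T, x - t' ∉ B).card = Y.card := by
      rw [← Finset.card_filter_add_card_filter_not (s := Y) (fun x => x - t ∈ B)]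
      congr 2
      ext x
      simp only [hY, Finset.mem_filter, Finset.mem_univ, true_and, Finset.forall_mem_insert]
      tauto
    have hsplit' : ((Y.filter fun x => x - t ∈ B).card : ℝ) +
      (Finset.univ.filter fun x : G => ∀ t' ∈ insert t T, x - t' ∉ B).card = Y.card := by
      exact_mod_cast hsplit
    have hB : (B.card : ℝ) / Fintype.card G ≤ 1 := by
      rw [div_le_one hG]; exact_mod_cast Finset.card_le_univ B
    calc _ ≤ (Y.card : ℝ) * (1 - B.card / Fintype.card G) := by
          have : (Y.card * B.card / Fintype.card G : ℝ) = Y.card * (B.card / Fintype.card G) := by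
            ring
          rw [this] at ht; linarith
      _ ≤ _ := by
          rw [pow_succ, ← mul_assoc]
          exact mul_le_mul_of_nonneg_right hX (by linarith)

/-- A set of density `β` covers a finite group with `⌈log |G| / β⌉ + 1` translates. -/
theorem exists_translates_cover {G : Type*} [AddCommGroup G] [Fintype G] [DecidableEq G]
    (B : Finset G) : ∃ T : Finset G,
      (T.card : ℝ) * B.card ≤ (Real.log (Fintype.card G) + 2) * Fintype.card G ∧
      (B.Nonempty → ∀ x : G, ∃ t ∈ T, x - t ∈ B) := by
  have hG : (0 : ℝ) < Fintype.card G := by exact_mod_cast Fintype.card_pos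
  have hG1 : (1 : ℝ) ≤ Fintype.card G := by exact_mod_cast Fintype.card_pos
  rcases B.eq_empty_or_nonempty with rfl | hB
  · refine ⟨∅, ?_, by simp⟩
    have := Real.log_nonneg hG1
    simp; positivity
  have hBpos : (0 : ℝ) < B.card := by exact_mod_cast hB.card_pos
  set β : ℝ := B.card / Fintype.card G with hβ
  have hβ0 : 0 < β := by positivity
  have hβ1 : β ≤ 1 := by
    rw [hβ, div_le_one hG]; exact_mod_cast Finset.card_le_univ B
  obtain ⟨T, hT, hX⟩ := exists_translates_card_compl_le B (⌊Real.log (Fintype.card G) / β⌋₊ + 1)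
  refine ⟨T, ?_, fun _ => ?_⟩
  · have h1 : (T.card : ℝ) ≤ Real.log (Fintype.card G) / β + 1 := by
      have h2 : (T.card : ℝ) ≤ ⌊Real.log (Fintype.card G) / β⌋₊ + 1 := by exact_mod_cast hT
      have := Nat.floor_le (show 0 ≤ Real.log (Fintype.card G) / β from
        div_nonneg (Real.log_nonneg hG1) hβ0.le)
      linarith
    have h3 : (B.card : ℝ) = β * Fintype.card G := by rw [hβ, div_mul_cancel₀ _ hG.ne']
    calc (T.card : ℝ) * B.card ≤ (Real.log (Fintype.card G) / β + 1) * (β * Fintype.card G) := by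
          rw [h3]; exact mul_le_mul_of_nonneg_right h1 (mul_nonneg hβ0.le hG.le)
      _ = (Real.log (Fintype.card G) + β) * Fintype.card G := by
          rw [← mul_assoc, add_mul, div_mul_cancel₀ _ hβ0.ne', one_mul]
      _ ≤ _ := mul_le_mul_of_nonneg_right (by linarith) hG.le
  · have hlt : (Fintype.card G : ℝ) * (1 - β) ^ (⌊Real.log (Fintype.card G) / β⌋₊ + 1) < 1 := by
      have h1 : (1 - β) ^ (⌊Real.log (Fintype.card G) / β⌋₊ + 1) ≤
          Real.exp (-β) ^ (⌊Real.log (Fintype.card G) / β⌋₊ + 1) := by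
        apply pow_le_pow_left₀ (by linarith)
        have := Real.add_one_le_exp (-β); linarith
      have h2 : Real.exp (-β) ^ (⌊Real.log (Fintype.card G) / β⌋₊ + 1) <
          Real.exp (-Real.log (Fintype.card G)) := by
        rw [← Real.exp_nat_mul, Real.exp_lt_exp]
        have h3 := Nat.lt_floor_add_one (Real.log (Fintype.card G) / β)
        rw [div_lt_iff₀ hβ0] at h3
        push_cast
        linarith
      rw [Real.exp_neg (Real.log _), Real.exp_log hG] at h2
      calc _ < (Fintype.card G : ℝ) * (Fintype.card G : ℝ)⁻¹ := by
            gcongr; exact h1.trans_lt h2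
        _ = 1 := by field_simp
    have hempty := hX.trans_lt hlt
    have h0 : (Finset.univ.filter fun x : G => ∀ t ∈ T, x - t ∉ B).card = 0 := by
      have : ((Finset.univ.filter fun x : G => ∀ t ∈ T, x - t ∉ B).card : ℝ) < (1 : ℕ) := by
        simpa using hempty
      have := Nat.cast_lt.1 this
      omega
    intro x
    by_contra! hcon
    rw [Finset.card_eq_zero, Finset.filter_eq_empty_iff] at h0
    exact h0 (Finset.mem_univ x) hcon

/-- `card_ge_of_lines` for lines whose directions lie in a subset `B`. -/
theorem card_mul_le_of_lines_mem (p : ℕ) [hp : Fact p.Prime] {κ m D M N : ℕ} (hD : D < p ^ κ)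
    (hN : M + m * (D * κ) ≤ N) (E : Finset (ZMod (p ^ κ) × (Fin m → ZMod (p ^ κ))))
    (B : Finset (Fin m → ZMod (p ^ κ)))
    (h : ∀ b ∈ B, ∃ a : ZMod (p ^ κ) × (Fin m → ZMod (p ^ κ)),
      N ≤ (Finset.univ.filter fun t : ZMod (p ^ κ) => a + t • (1, b) ∈ E).card) :
    (B.card : ℝ) * (M * (D + 1) ^ m : ℕ) ≤
      (Real.log ((p : ℝ) ^ (κ * m)) + 2) * (p : ℝ) ^ (κ * m) * E.card := by
  classical
  obtain ⟨T, hTcard, hT⟩ := exists_translates_cover B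
  have hG : (Fintype.card (Fin m → ZMod (p ^ κ)) : ℝ) = (p : ℝ) ^ (κ * m) := by
    simp [ZMod.card, pow_mul]
  rw [hG] at hTcard
  rcases B.eq_empty_or_nonempty with rfl | hB
  · have : 0 ≤ Real.log ((p : ℝ) ^ (κ * m)) := Real.log_nonneg
      (one_le_pow₀ (by exact_mod_cast hp.out.one_lt.le))
    simp; positivity
  let sh : (Fin m → ZMod (p ^ κ)) → ZMod (p ^ κ) × (Fin m → ZMod (p ^ κ)) →
    ZMod (p ^ κ) × (Fin m → ZMod (p ^ κ)) := fun t x => (x.1, x.2 + x.1 • t)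
  let E' := T.biUnion fun t => E.image (sh t)
  have hE' : E'.card ≤ T.card * E.card :=
    Finset.card_biUnion_le_card_mul _ _ _ fun t _ => Finset.card_image_le
  have hmain := card_ge_of_lines p hD hN E' (by
    intro b
    obtain ⟨t, ht, hbt⟩ := hT hB b
    obtain ⟨a, ha⟩ := h _ hbt
    refine ⟨sh t a, ha.trans (Finset.card_le_card ?_)⟩
    intro s hs
    rw [Finset.mem_filter] at hs ⊢
    refine ⟨Finset.mem_univ _, Finset.mem_biUnion.2 ⟨t, ht, Finset.mem_image.2 ⟨_, hs.2, ?_⟩⟩⟩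
    simp only [sh]
    ext
    · simp
    · simp; ring)
  calc (B.card : ℝ) * (M * (D + 1) ^ m : ℕ) ≤ B.card * (T.card * E.card : ℕ) := by
        exact mul_le_mul_of_nonneg_left (Nat.cast_le.2 (hmain.trans hE')) (by positivity)
    _ = T.card * B.card * E.card := by push_cast; ring
    _ ≤ _ := by gcongr

theorem ZMod.sum_eq_sum_range {n : ℕ} [NeZero n] (F : ZMod n → ℝ) :
    ∑ r, F r = ∑ i ∈ Finset.range n, F i := by
  refine Finset.sum_bij' (fun r _ => r.val) (fun i _ => (i : ZMod n)) ?_ ?_ ?_ ?_ ?_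
  · intro r _; simpa using ZMod.val_lt r
  · intro i _; simp
  · intro r _; simp
  · intro i hi; exact ZMod.val_cast_of_lt (by simpa using hi)
  · intro r _; simp

theorem Finset.sum_range_mul_of_periodic (H : ℕ → ℝ) (a : ℕ) (hH : ∀ i, H (a + i) = H i) (k : ℕ) :
    ∑ i ∈ Finset.range (a * k), H i = k * ∑ i ∈ Finset.range a, H i := by
  induction k with
  | zero => simp
  | succ k ih =>
    rw [Nat.mul_succ, add_comm, Finset.sum_range_add]
    simp only [hH]
    rw [ih]; push_cast; ring

theorem ZMod.sum_mul_prime_eq (p : ℕ) [hp : Fact p.Prime] (e : ℕ) (h : ZMod (p ^ (e + 1)) → ℝ)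
    [DecidablePred fun r : ZMod (p ^ (e + 1)) => IsUnit r] :
    ∑ r, h ((p : ZMod (p ^ (e + 1))) * r) =
      p * ∑ r ∈ Finset.univ.filter fun r : ZMod (p ^ (e + 1)) => ¬ IsUnit r, h r := by
  classical
  rw [ZMod.sum_eq_sum_range, Finset.sum_filter, ZMod.sum_eq_sum_range]
  have h1 := Finset.sum_range_mul_of_periodic
    (fun i : ℕ => h ((p : ZMod (p ^ (e + 1))) * (i : ZMod (p ^ (e + 1))))) (p ^ e) (by
      intro i
      congr 1
      have : (p : ZMod (p ^ (e + 1))) * (p : ZMod (p ^ (e + 1))) ^ e = 0 := by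
        rw [← pow_succ', ← Nat.cast_pow, ZMod.natCast_self]
      push_cast
      linear_combination this) p
  rw [← pow_succ] at h1
  rw [h1]
  congr 1
  rw [← Finset.sum_filter]
  refine Finset.sum_bij' (fun i _ => p * i) (fun i _ => i / p) ?_ ?_ ?_ ?_ ?_
  · intro i hi
    rw [Finset.mem_range] at hi
    rw [Finset.mem_filter, Finset.mem_range, ZMod.isUnit_iff_coprime]
    refine ⟨by rw [pow_succ']; exact (Nat.mul_lt_mul_left hp.out.pos).2 hi, fun hc => ?_⟩
    have : p.Coprime (p ^ (e + 1)) := Nat.Coprime.coprime_mul_right hc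
    rw [Nat.coprime_pow_right_iff (by omega), Nat.coprime_self] at this
    exact hp.out.ne_one this
  · intro i hi
    rw [Finset.mem_filter, Finset.mem_range] at hi
    rw [Finset.mem_range]
    exact Nat.div_lt_of_lt_mul (by rw [← pow_succ']; exact hi.1)
  · intro i _; exact Nat.mul_div_cancel_left i hp.out.pos
  · intro i hi
    rw [Finset.mem_filter, ZMod.isUnit_iff_coprime, Nat.coprime_pow_right_iff (by omega),
      Nat.coprime_comm, hp.out.coprime_iff_not_dvd, not_not] at hi
    exact Nat.mul_div_cancel' hi.2
  · intro i _; simp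

theorem card_mul_sum_sum_eq {R M : Type*} [Ring R] [AddCommGroup M] [Module R M] [Fintype M]
    (g : M → ℝ) (P : R) :
    (Fintype.card M : ℝ) * ∑ w, ∑ y, g w * g (w + P • y) = ∑ w, (∑ y, g (w + P • y)) ^ 2 := by
  have h1 : ∀ y y' : M, ∑ w, g (w + P • y) * g (w + P • y') =
      ∑ w, g w * g (w + P • (y' - y)) := by
    intro y y'
    rw [← _root_.Equiv.sum_comp (Equiv.addRight (P • y)) (fun w => g w * g (w + P • (y' - y)))]
    refine Finset.sum_congr rfl fun w _ => ?_
    simp only [Equiv.coe_addRight]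
    rw [smul_sub]; congr 2; abel
  symm
  calc ∑ w, (∑ y, g (w + P • y)) ^ 2 = ∑ y, ∑ y', ∑ w, g (w + P • y) * g (w + P • y') := by
        simp only [sq, Finset.sum_mul_sum]
        rw [Finset.sum_comm]
        exact Finset.sum_congr rfl fun y _ => Finset.sum_comm
    _ = ∑ y : M, ∑ y', ∑ w, g w * g (w + P • y') := by
        refine Finset.sum_congr rfl fun y _ => ?_
        rw [← _root_.Equiv.sum_comp (Equiv.subRight y) (fun y' => ∑ w, g w * g (w + P • y'))]
        exact Finset.sum_congr rfl fun y' _ => h1 y y'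
    _ = _ := by
        rw [Finset.sum_const, nsmul_eq_mul, Finset.card_univ, Finset.sum_comm]

section
variable {p : ℕ} [hp : Fact p.Prime] {e : ℕ} {M : Type*} [AddCommGroup M]
  [Module (ZMod (p ^ (e + 1))) M] [Fintype M]

theorem sum_sum_smul_eq (f : ZMod (p ^ (e + 1)) × M → ℝ)
    (hf : ∀ x, ∑ z, f (x + ((p : ZMod (p ^ (e + 1))) ^ e) • z) = 0)
    (s : ZMod (p ^ (e + 1))) (w : M) :
    ∑ r, ∑ y, f (s + r, w + r • y) =
      Fintype.card M * f (s, w) - ∑ y, f (s, w + ((p : ZMod (p ^ (e + 1))) ^ e) • y) := by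
  classical
  obtain ⟨P, hP⟩ : ∃ P : ZMod (p ^ (e + 1)), P = (p : ZMod (p ^ (e + 1))) := ⟨_, rfl⟩
  rw [← hP] at hf ⊢
  have hPtop : P ^ (e + 1) = 0 := by rw [hP, ← Nat.cast_pow, ZMod.natCast_self]
  have hp0 : (p : ℝ) ≠ 0 := by exact_mod_cast hp.out.ne_zero
  have havg : ∀ i j : ℕ, i ≤ e → j ≤ e → ∑ r, ∑ y, f (s + P ^ i * r, w + P ^ j • y) = 0 := by
    intro i j hi hj
    have h1 : ∀ r' : ZMod (p ^ (e + 1)), ∀ y' : M,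
        ∑ r, ∑ y, f (s + P ^ i * r, w + P ^ j • y) =
        ∑ r, ∑ y, f (s + P ^ i * r + P ^ e * r', w + P ^ j • y + P ^ e • y') := by
      intro r' y'
      rw [← _root_.Equiv.sum_comp (Equiv.addRight (P ^ (e - i) * r'))]
      refine Finset.sum_congr rfl fun r _ => ?_
      rw [← _root_.Equiv.sum_comp (Equiv.addRight (P ^ (e - j) • y'))]
      refine Finset.sum_congr rfl fun y _ => ?_
      simp only [Equiv.coe_addRight]
      rw [mul_add, smul_add, ← mul_assoc, smul_smul, ← pow_add, ← pow_add,
        Nat.add_sub_cancel' hi, Nat.add_sub_cancel' hj, add_assoc, add_assoc]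
    have h2 : ∑ r' : ZMod (p ^ (e + 1)), ∑ y' : M,
        ∑ r, ∑ y, f (s + P ^ i * r, w + P ^ j • y) = 0 := by
      rw [Finset.sum_congr rfl fun r' _ => Finset.sum_congr rfl fun y' _ => h1 r' y',
        ← Fintype.sum_prod_type' fun r' y' =>
          ∑ r, ∑ y, f (s + P ^ i * r + P ^ e * r', w + P ^ j • y + P ^ e • y'), Finset.sum_comm]
      refine Finset.sum_eq_zero fun r _ => ?_
      rw [Finset.sum_comm]
      refine Finset.sum_eq_zero fun y _ => ?_
      exact hf (s + P ^ i * r, w + P ^ j • y)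
    simp only [Finset.sum_const, nsmul_eq_mul, Finset.card_univ] at h2
    rcases mul_eq_zero.1 h2 with h | h
    · exact absurd h (by exact_mod_cast Fintype.card_ne_zero)
    rcases mul_eq_zero.1 h with h | h
    · exact absurd h (by have : Nonempty M := ⟨0⟩; exact_mod_cast Fintype.card_ne_zero)
    · exact h
  let T : ℕ → ℝ := fun j => ∑ r, ∑ y, f (s + P ^ j * r, w + (P ^ j * r) • y)
  have hrec : ∀ j ≤ e, p * T j = T (j + 1) - ∑ r, ∑ y, f (s + P ^ (j + 1) * r, w + P ^ j • y) := by
    intro j hj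
    have h1 := ZMod.sum_mul_prime_eq p e
      (fun r => ∑ y, f (s + P ^ j * r, w + (P ^ j * r) • y))
    have h2 := ZMod.sum_mul_prime_eq p e (fun r => ∑ y, f (s + P ^ j * r, w + P ^ j • y))
    have h3 : ∑ r ∈ Finset.univ.filter (fun r : ZMod (p ^ (e + 1)) => IsUnit r),
        ∑ y, f (s + P ^ j * r, w + (P ^ j * r) • y) =
        ∑ r ∈ Finset.univ.filter (fun r : ZMod (p ^ (e + 1)) => IsUnit r),
        ∑ y, f (s + P ^ j * r, w + P ^ j • y) := by
      refine Finset.sum_congr rfl fun r hr => ?_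
      obtain ⟨u, rfl⟩ := (Finset.mem_filter.1 hr).2
      rw [← _root_.Equiv.sum_comp (MulAction.toPerm u : Equiv.Perm M)
        (fun y => f (s + P ^ j * u, w + P ^ j • y))]
      refine Finset.sum_congr rfl fun y _ => ?_
      rw [MulAction.toPerm_apply, Units.smul_def, smul_smul]
    have h4 := havg j j hj hj
    rw [← Finset.sum_filter_add_sum_filter_not _ (fun r : ZMod (p ^ (e + 1)) => IsUnit r)] at h4
    simp only [← mul_assoc, ← pow_succ, ← hP] at h1 h2
    simp only [T]
    rw [← Finset.sum_filter_add_sum_filter_not _ (fun r : ZMod (p ^ (e + 1)) => IsUnit r),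
      h3, h1, h2]
    linear_combination (p : ℝ) * h4
  have hT : ∀ j ≤ e, T j = (p : ℝ) ^ j * T 0 := by
    intro j
    induction j with
    | zero => intro _; simp
    | succ j ih =>
      intro hj
      have := hrec j (by omega)
      rw [havg (j + 1) j hj (by omega), sub_zero, ih (by omega)] at this
      rw [← this]; ring
  have hlast := hrec e le_rfl
  rw [hT e le_rfl] at hlast
  simp only [T, hPtop, zero_mul, add_zero, zero_smul, Finset.sum_const, nsmul_eq_mul,
    Finset.card_univ, ZMod.card, pow_zero, one_mul] at hlast
  have hq0 : (p : ℝ) ^ (e + 1) ≠ 0 := pow_ne_zero _ hp0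
  apply mul_left_cancel₀ hq0
  rw [Nat.cast_pow] at hlast
  linear_combination hlast

/-- `L²` bound for projections along the directions `(1, y)` of a function whose averages over
cosets of `p^e` vanish. -/
theorem sum_sq_projection_le (f : ZMod (p ^ (e + 1)) × M → ℝ)
    (hf : ∀ x, ∑ z, f (x + ((p : ZMod (p ^ (e + 1))) ^ e) • z) = 0) :
    ∑ y, ∑ w, (∑ s, f (s, w + s • y)) ^ 2 ≤ Fintype.card M * ∑ x, f x ^ 2 := by
  have : Nonempty M := ⟨0⟩
  have hexp : ∑ y, ∑ w, (∑ s, f (s, w + s • y)) ^ 2 =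
      ∑ s, ∑ w, f (s, w) * ∑ r, ∑ y, f (s + r, w + r • y) := by
    have h1 : ∀ y, ∑ w, (∑ s, f (s, w + s • y)) ^ 2 =
        ∑ s, ∑ w, ∑ r, f (s, w) * f (s + r, w + r • y) := by
      intro y
      simp only [sq, Finset.sum_mul_sum]
      rw [Finset.sum_comm]
      refine Finset.sum_congr rfl fun s _ => ?_
      rw [← _root_.Equiv.sum_comp (Equiv.addRight (s • y))
        (fun w => ∑ r, f (s, w) * f (s + r, w + r • y))]
      refine Finset.sum_congr rfl fun w _ => ?_
      rw [← _root_.Equiv.sum_comp (Equiv.addLeft s) (fun s' => f (s, w + s • y) * f (s', w + s' • y))]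
      refine Finset.sum_congr rfl fun r _ => ?_
      simp only [Equiv.coe_addRight, Equiv.coe_addLeft]
      rw [add_smul, add_assoc]
    simp only [h1]
    rw [Finset.sum_comm]
    refine Finset.sum_congr rfl fun s _ => ?_
    rw [Finset.sum_comm]
    refine Finset.sum_congr rfl fun w _ => ?_
    rw [Finset.sum_comm]
    simp only [Finset.mul_sum]
  rw [hexp]
  simp only [sum_sum_smul_eq f hf, mul_sub, Finset.sum_sub_distrib]
  have h2 : ∀ s, 0 ≤ ∑ w, f (s, w) * ∑ y, f (s, w + ((p : ZMod (p ^ (e + 1))) ^ e) • y) := by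
    intro s
    have h3 := card_mul_sum_sum_eq (fun w => f (s, w)) ((p : ZMod (p ^ (e + 1))) ^ e)
    have h4 : (0 : ℝ) < Fintype.card M := by exact_mod_cast Fintype.card_pos
    have h5 : 0 ≤ (Fintype.card M : ℝ) *
        ∑ w, ∑ y, f (s, w) * f (s, w + ((p : ZMod (p ^ (e + 1))) ^ e) • y) := by
      rw [h3]; positivity
    have h6 := nonneg_of_mul_nonneg_right h5 h4
    simpa only [Finset.mul_sum] using h6
  have h7 : ∑ s, ∑ w, f (s, w) * ((Fintype.card M : ℝ) * f (s, w)) =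
      Fintype.card M * ∑ x, f x ^ 2 := by
    rw [Fintype.sum_prod_type, Finset.mul_sum]
    refine Finset.sum_congr rfl fun s _ => ?_
    rw [Finset.mul_sum]
    exact Finset.sum_congr rfl fun w _ => by ring
  rw [h7]
  have := Finset.sum_nonneg fun s (_ : s ∈ Finset.univ) => h2 s
  linarith

end

theorem le_add_sum_dyadic {η h : ℝ} (hη : 0 < η) (J : ℕ) (hJ : h < η * 2 ^ J / 2) :
    h ≤ η / 2 + ∑ i ∈ Finset.range J, if η * 2 ^ i / 2 ≤ h then η * 2 ^ i else 0 := by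
  induction J with
  | zero => simp at hJ ⊢; linarith
  | succ J ih =>
    rw [Finset.sum_range_succ]
    have h0 : 0 ≤ ∑ i ∈ Finset.range J, if η * 2 ^ i / 2 ≤ h then η * 2 ^ i else 0 :=
      Finset.sum_nonneg fun i _ => by split_ifs <;> positivity
    split_ifs with h1
    · rw [pow_succ] at hJ; linarith
    · have := ih (not_le.1 h1); linarith

/-- Dyadic pigeonholing: a function with average at least `η` has a popular dyadic level. -/
theorem exists_dyadic_level {ι : Type*} [Fintype ι] (h : ι → ℝ) {η : ℝ} (hη : 0 < η) {J : ℕ}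
    (hJ : Fintype.card ι ≤ 2 ^ J) (hι : 0 < Fintype.card ι) (hsum : η * Fintype.card ι ≤ ∑ t, h t) :
    ∃ i ∈ Finset.range (J + 1), η * Fintype.card ι ≤ 4 * (J + 1) * (η * 2 ^ i / 2 *
      (Finset.univ.filter fun t => η * 2 ^ i / 2 ≤ h t).card) := by
  by_contra! hcon
  have hιR : (0 : ℝ) < Fintype.card ι := by exact_mod_cast hι
  have hJR : (Fintype.card ι : ℝ) ≤ 2 ^ J := by exact_mod_cast hJ
  have htop : ∀ t, h t < η * 2 ^ J / 2 := by
    intro t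
    by_contra! ht
    have h1 := hcon J (by simp)
    have h2 : (1 : ℝ) ≤ (Finset.univ.filter fun t => η * 2 ^ J / 2 ≤ h t).card := by
      exact_mod_cast Finset.card_pos.2 ⟨t, by simpa using ht⟩
    have h3 : η * 2 ^ J / 2 ≤ η * 2 ^ J / 2 *
        (Finset.univ.filter fun t => η * 2 ^ J / 2 ≤ h t).card := le_mul_of_one_le_right (by positivity) h2
    have h4 : η * Fintype.card ι ≤ η * 2 ^ J := by gcongr
    have h5 : (4 : ℝ) * (η * 2 ^ J / 2) ≤ 4 * (J + 1) * (η * 2 ^ J / 2 *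
        (Finset.univ.filter fun t => η * 2 ^ J / 2 ≤ h t).card) := by
      have : (0 : ℝ) ≤ J := by positivity
      gcongr; linarith
    have : 0 < η * 2 ^ J := by positivity
    linarith
  have h1 : ∑ t, h t ≤ η / 2 * Fintype.card ι + ∑ i ∈ Finset.range J,
      η * 2 ^ i * (Finset.univ.filter fun t => η * 2 ^ i / 2 ≤ h t).card := by
    calc ∑ t, h t ≤ ∑ t, (η / 2 + ∑ i ∈ Finset.range J,
          if η * 2 ^ i / 2 ≤ h t then η * 2 ^ i else 0) :=
          Finset.sum_le_sum fun t _ => le_add_sum_dyadic hη J (htop t)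
      _ = _ := by
        rw [Finset.sum_add_distrib, Finset.sum_comm]
        congr 1
        · simp [mul_comm]
        · refine Finset.sum_congr rfl fun i _ => ?_
          rw [← Finset.sum_filter]; simp [mul_comm]
  have h2 : ∑ i ∈ Finset.range J,
      η * 2 ^ i * (Finset.univ.filter fun t => η * 2 ^ i / 2 ≤ h t).card ≤
      J * (η * Fintype.card ι / (2 * (J + 1))) := by
    rw [← nsmul_eq_mul, ← Finset.card_range J, ← Finset.sum_const]
    simp only [Finset.card_range]
    refine Finset.sum_le_sum fun i hi => ?_
    rw [le_div_iff₀ (by positivity)]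
    have := hcon i (by simp at hi ⊢; omega)
    linarith
  have h3 : J * (η * Fintype.card ι / (2 * (J + 1))) < η / 2 * Fintype.card ι := by
    rw [← mul_div_assoc, div_lt_iff₀ (by positivity)]
    nlinarith [mul_pos hη hιR]
  linarith

/-- The numerology of the number of conditions and of the degree. -/
theorem exists_degree (N m κ : ℕ) (hm : 1 ≤ m) (hκ : 1 ≤ κ) :
    ∃ D M : ℕ, 2 * D ≤ N ∧ M + m * (D * κ) ≤ N ∧
      (N : ℝ) ^ (m + 1) ≤ 2 * (2 * m * κ) ^ m * (M * (D + 1) ^ m : ℕ) := by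
  have hmκ : 0 < 2 * m * κ := by positivity
  have h1 : N / (2 * m * κ) * (2 * m * κ) ≤ N := Nat.div_mul_le_self _ _
  have h2 : N < (N / (2 * m * κ) + 1) * (2 * m * κ) := (Nat.div_lt_iff_lt_mul hmκ).1 (Nat.lt_succ_self _)
  generalize N / (2 * m * κ) = D at h1 h2
  have h3 : 2 * (m * (D * κ)) ≤ N := by linarith [h1, (by ring : D * (2 * m * κ) = 2 * (m * (D * κ)))]
  refine ⟨D, N - m * (D * κ), ?_, by omega, ?_⟩
  · have : D ≤ m * (D * κ) := by
      calc D = 1 * (D * 1) := by ring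
        _ ≤ m * (D * κ) := by gcongr
    omega
  · have h4 : N ≤ 2 * (N - m * (D * κ)) := by omega
    have h5 : N ^ (m + 1) ≤ 2 * (2 * m * κ) ^ m * ((N - m * (D * κ)) * (D + 1) ^ m) := by
      calc N ^ (m + 1) = N ^ m * N := pow_succ _ _
        _ ≤ ((D + 1) * (2 * m * κ)) ^ m * (2 * (N - m * (D * κ))) := by gcongr
        _ = _ := by rw [mul_pow]; ring
    exact_mod_cast h5

theorem exists_le_card_mul_card_filter {α β : Type*} [DecidableEq β] (G : Finset α) (s : Finset β)
    (φ : α → β) (h : ∀ x ∈ G, φ x ∈ s) (hG : G.Nonempty) :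
    ∃ i ∈ s, G.card ≤ s.card * (G.filter fun x => φ x = i).card := by
  by_contra! hcon
  have hs : s.Nonempty := ⟨_, h _ hG.choose_spec⟩
  have h1 := Finset.card_eq_sum_card_fiberwise h
  have h2 : s.card * G.card = ∑ i ∈ s, s.card * (G.filter fun x => φ x = i).card := by
    rw [← Finset.mul_sum, ← h1]
  have h3 := Finset.sum_lt_sum_of_nonempty hs hcon
  rw [← h2] at h3
  simp at h3

/-- Single-scale estimate: a function bounded by `1` whose averages over cosets of `p^e` vanish and
which has large averages on planes in many directions has a large `L²` norm. -/
theorem card_mul_le_sum_sq_of_planes (p : ℕ) [hp : Fact p.Prime] {e m : ℕ} (hm : 1 ≤ m)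
    (f : ZMod (p ^ (e + 1)) × ZMod (p ^ (e + 1)) × (Fin m → ZMod (p ^ (e + 1))) → ℝ)
    (hf1 : ∀ x, f x ≤ 1)
    (hf : ∀ x, ∑ z, f (x + ((p : ZMod (p ^ (e + 1))) ^ e) • z) = 0) {η : ℝ} (hη : 0 < η)
    (G : Finset ((ZMod (p ^ (e + 1)) × (Fin m → ZMod (p ^ (e + 1)))) ×
      (Fin m → ZMod (p ^ (e + 1)))))
    (hG : ∀ g ∈ G, ∃ a, η * ((p : ℝ) ^ (e + 1)) ^ 2 ≤
      ∑ s : ZMod (p ^ (e + 1)), ∑ t : ZMod (p ^ (e + 1)), f (a + s • (1, g.1) + t • (0, 1, g.2))) :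
    G.card * η ^ (m + 1) * ((p : ℝ) ^ (e + 1)) ^ 2 ≤
      ((p + 1) * (4 * (p + 1)) ^ (m + 1) * (2 * (2 * m) ^ m) * (m * p + 2)) *
        (e + 1 : ℝ) ^ (2 * m + 3) * (((p : ℝ) ^ (e + 1)) ^ m * ∑ x, f x ^ 2) := by
  classical
  rcases G.eq_empty_or_nonempty with rfl | hGne
  · simp only [Finset.card_empty, Nat.cast_zero, zero_mul]
    have : 0 ≤ ∑ x, f x ^ 2 := Finset.sum_nonneg fun _ _ => sq_nonneg _
    positivity
  obtain ⟨q, hq⟩ : ∃ q : ℝ, q = (p : ℝ) ^ (e + 1) := ⟨_, rfl⟩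
  have hp1 : (1 : ℝ) < p := by exact_mod_cast hp.out.one_lt
  have hq0 : 0 < q := by rw [hq]; positivity
  have hcard : Fintype.card (ZMod (p ^ (e + 1))) = p ^ (e + 1) := ZMod.card _
  have hcardR : (Fintype.card (ZMod (p ^ (e + 1))) : ℝ) = q := by rw [hcard, hq]; push_cast; rfl
  obtain ⟨J, hJ⟩ : ∃ J : ℕ, J = p * (e + 1) := ⟨_, rfl⟩
  have hJq : Fintype.card (ZMod (p ^ (e + 1))) ≤ 2 ^ J := by
    rw [hcard, hJ, pow_mul]; exact Nat.pow_le_pow_left (Nat.lt_two_pow_self).le _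
  let h : ZMod (p ^ (e + 1)) × (Fin m → ZMod (p ^ (e + 1))) →
    ZMod (p ^ (e + 1)) × (Fin m → ZMod (p ^ (e + 1))) → ℝ :=
    fun y u => (∑ s, f (s, u + s • y)) / q
  have hh1 : ∀ y u, h y u ≤ 1 := by
    intro y u
    rw [div_le_one hq0]
    calc ∑ s, f (s, u + s • y) ≤ ∑ s : ZMod (p ^ (e + 1)), (1 : ℝ) :=
          Finset.sum_le_sum fun s _ => hf1 _
      _ = q := by rw [Finset.sum_const, Finset.card_univ, nsmul_eq_mul, hcardR, mul_one]
  have hlev : ∀ g : (ZMod (p ^ (e + 1)) × (Fin m → ZMod (p ^ (e + 1)))) ×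
      (Fin m → ZMod (p ^ (e + 1))), ∃ i : ℕ, ∃ a, g ∈ G → i ∈ Finset.range (J + 1) ∧
      η * q ≤ 4 * (J + 1) * (η * 2 ^ i / 2 *
        (Finset.univ.filter fun t : ZMod (p ^ (e + 1)) =>
          η * 2 ^ i / 2 ≤ h g.1 (a + t • (1, g.2))).card) := by
    intro g
    by_cases hgG : g ∈ G
    swap
    · exact ⟨0, 0, fun h => absurd h hgG⟩
    obtain ⟨a, ha⟩ := hG g hgG
    have hsum : η * Fintype.card (ZMod (p ^ (e + 1))) ≤
        ∑ t : ZMod (p ^ (e + 1)), h g.1 (a.2 - a.1 • g.1 + t • (1, g.2)) := by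
      have h1 : ∀ t : ZMod (p ^ (e + 1)), ∑ s : ZMod (p ^ (e + 1)),
          f (a + s • (1, g.1) + t • (0, 1, g.2)) =
          q * h g.1 (a.2 - a.1 • g.1 + t • (1, g.2)) := by
        intro t
        simp only [h]
        rw [mul_div_cancel₀ _ hq0.ne', ← _root_.Equiv.sum_comp (Equiv.addLeft (-a.1))]
        refine Finset.sum_congr rfl fun s _ => ?_
        congr 1
        refine Prod.ext ?_ ?_
        · simp
        · simp only [Prod.snd_add, Prod.smul_snd, Equiv.coe_addLeft, add_smul, neg_smul,
            Prod.snd_neg]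
          abel
      rw [Finset.sum_comm, Finset.sum_congr rfl fun t _ => h1 t, ← Finset.mul_sum, ← hq] at ha
      rw [hcardR]
      have : q * (η * q) ≤ q * ∑ t : ZMod (p ^ (e + 1)),
        h g.1 (a.2 - a.1 • g.1 + t • (1, g.2)) := by linarith
      exact le_of_mul_le_mul_left this hq0
    obtain ⟨i, hi, hi'⟩ := exists_dyadic_level _ hη hJq Fintype.card_pos hsum
    rw [hcardR] at hi'
    exact ⟨i, _, fun _ => ⟨hi, hi'⟩⟩
  choose φ A hφ using hlev
  obtain ⟨i, hi, hGi⟩ := exists_le_card_mul_card_filter G (Finset.range (J + 1)) φ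
    (fun x hx => (hφ x hx).1) hGne
  rw [Finset.card_range] at hGi
  obtain ⟨τ, hτ⟩ : ∃ τ : ℝ, τ = η * 2 ^ i / 2 := ⟨_, rfl⟩
  have hτ0 : 0 < τ := by rw [hτ]; positivity
  obtain ⟨G', hG'⟩ : ∃ G', G' = G.filter fun x => φ x = i := ⟨_, rfl⟩
  rw [← hG'] at hGi
  have hN : ∀ g ∈ G', η * q / (4 * (J + 1) * τ) ≤ (Finset.univ.filter fun t : ZMod (p ^ (e + 1)) =>
          τ ≤ h g.1 (A g + t • (1, g.2))).card := by
    intro g hg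
    rw [hG', Finset.mem_filter] at hg
    have := (hφ g hg.1).2
    rw [hg.2, ← hτ] at this
    rw [div_le_iff₀ (by positivity)]
    linarith
  have hG'ne : G'.Nonempty := by
    rw [← Finset.card_pos]
    exact Nat.pos_of_ne_zero fun h0 => by
      rw [h0] at hGi; exact absurd (Finset.card_pos.2 hGne) (by omega)
  obtain ⟨N, hNdef⟩ : ∃ N : ℕ, N = ⌈η * q / (4 * (J + 1) * τ)⌉₊ := ⟨_, rfl⟩
  have hN' : ∀ g ∈ G', N ≤ (Finset.univ.filter fun t : ZMod (p ^ (e + 1)) =>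
          τ ≤ h g.1 (A g + t • (1, g.2))).card := fun g hg => by
    rw [hNdef]; exact Nat.ceil_le.2 (hN g hg)
  have hNpos : 0 < N := by rw [hNdef]; exact Nat.ceil_pos.2 (by positivity)
  have hNle : η * q / (4 * (J + 1) * τ) ≤ N := by rw [hNdef]; exact Nat.le_ceil _
  obtain ⟨g₀, hg₀⟩ := hG'ne
  have hNq : N ≤ p ^ (e + 1) := (hN' g₀ hg₀).trans ((Finset.card_le_univ _).trans hcard.le)
  have hτ1 : τ ≤ 1 := by
    obtain ⟨t, ht⟩ := Finset.card_pos.1 (hNpos.trans_le (hN' g₀ hg₀))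
    exact (Finset.mem_filter.1 ht).2.trans (hh1 _ _)
  obtain ⟨D, M, hD, hM, hDM⟩ := exists_degree N m (e + 1) hm (by omega)
  have hDq : D < p ^ (e + 1) := by omega
  let E := fun y => Finset.univ.filter fun u => τ ≤ h y u
  let L : ℝ := Real.log ((p : ℝ) ^ ((e + 1) * m)) + 2
  have hB : ∀ y, ((G'.filter fun g => g.1 = y).card : ℝ) * (M * (D + 1) ^ m : ℕ) ≤
      L * q ^ m * (E y).card := by
    intro y
    have := card_mul_le_of_lines_mem p hDq hM (E y) ((G'.filter fun g => g.1 = y).image Prod.snd) (by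
      intro b hb
      obtain ⟨g, hg, rfl⟩ := Finset.mem_image.1 hb
      rw [Finset.mem_filter] at hg
      refine ⟨A g, (hN' g hg.1).trans (le_of_eq ?_)⟩
      rw [hg.2]
      congr 1
      ext t
      simp [E])
    rw [Finset.card_image_of_injOn, pow_mul, ← hq] at this
    · simpa only [L, pow_mul, ← hq] using this
    · intro g hg g' hg' hgg
      simp only [Finset.coe_filter, Set.mem_ofPred_eq] at hg hg'
      exact Prod.ext (hg.2.trans hg'.2.symm) hgg
  have hsumB : (G'.card : ℝ) * (M * (D + 1) ^ m : ℕ) ≤ L * q ^ m * ∑ y, ((E y).card : ℝ) := by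
    rw [Finset.card_eq_sum_card_fiberwise (f := Prod.fst) (t := Finset.univ)
      (fun _ _ => Finset.mem_coe.2 (Finset.mem_univ _)), Nat.cast_sum, Finset.sum_mul,
      Finset.mul_sum]
    exact Finset.sum_le_sum fun y _ => hB y
  have hL2 := sum_sq_projection_le f hf
  have hcardM : (Fintype.card (ZMod (p ^ (e + 1)) × (Fin m → ZMod (p ^ (e + 1)))) : ℝ) =
      q ^ (m + 1) := by
    rw [Fintype.card_prod, Fintype.card_fun, Fintype.card_fin, Nat.cast_mul, Nat.cast_pow, hcardR]
    ring
  rw [hcardM] at hL2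
  have hE : q ^ 2 * (τ ^ 2 * ∑ y, ((E y).card : ℝ)) ≤ q ^ (m + 1) * ∑ x, f x ^ 2 := by
    refine le_trans ?_ hL2
    rw [Finset.mul_sum, Finset.mul_sum]
    refine Finset.sum_le_sum fun y _ => ?_
    calc q ^ 2 * (τ ^ 2 * (E y).card) = ∑ u ∈ E y, (q * τ) ^ 2 := by
          rw [Finset.sum_const, nsmul_eq_mul]; ring
      _ ≤ ∑ u ∈ E y, (∑ s, f (s, u + s • y)) ^ 2 := by
          refine Finset.sum_le_sum fun u hu => ?_
          have hu' : τ ≤ (∑ s, f (s, u + s • y)) / q := (Finset.mem_filter.1 hu).2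
          rw [le_div_iff₀ hq0] at hu'
          rw [mul_comm]
          gcongr
      _ ≤ _ := Finset.sum_le_univ_sum_of_nonneg fun _ => sq_nonneg _
  have hτN : (η * q / (4 * (J + 1))) ^ (m + 1) ≤ τ ^ 2 * (N : ℝ) ^ (m + 1) := by
    have h1 : η * q / (4 * (J + 1)) ≤ τ * N := by
      rw [← div_div, div_le_iff₀ hτ0] at hNle; linarith
    calc (η * q / (4 * (J + 1))) ^ (m + 1) ≤ (τ * N) ^ (m + 1) := by gcongr
      _ = τ ^ (m + 1) * (N : ℝ) ^ (m + 1) := mul_pow _ _ _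
      _ ≤ _ := by
        exact mul_le_mul_of_nonneg_right (pow_le_pow_of_le_one hτ0.le hτ1 (by omega)) (by positivity)
  have hL : L ≤ (e + 1) * (m * p + 2) := by
    simp only [L, Real.log_pow]
    have h1 : Real.log p ≤ p := (Real.log_le_sub_one_of_pos (by linarith)).trans (by linarith)
    push_cast
    have : ((e : ℝ) + 1) * m * Real.log p ≤ (e + 1) * m * p := by gcongr
    nlinarith
  have hJ1 : (J : ℝ) + 1 ≤ (e + 1) * (p + 1) := by
    rw [hJ]; push_cast; nlinarith [(Nat.cast_nonneg e : (0 : ℝ) ≤ e)]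
  have hGR : (G.card : ℝ) ≤ (J + 1) * G'.card := by exact_mod_cast hGi
  have hsq : 0 ≤ ∑ x, f x ^ 2 := Finset.sum_nonneg fun _ _ => sq_nonneg _
  rw [← hq]
  have hL0 : 0 ≤ L := by
    have : 0 ≤ Real.log ((p : ℝ) ^ ((e + 1) * m)) := Real.log_nonneg (one_le_pow₀ hp1.le)
    simp only [L]; linarith
  refine le_of_mul_le_mul_right ?_ (show 0 < q ^ (m + 1) by positivity)
  calc G.card * η ^ (m + 1) * q ^ 2 * q ^ (m + 1)
      = G.card * q ^ 2 * ((4 * (J + 1)) ^ (m + 1) * (η * q / (4 * (J + 1))) ^ (m + 1)) := by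
        rw [← mul_pow, mul_div_cancel₀ _ (by positivity), mul_pow]; ring
    _ ≤ ((J + 1) * G'.card) * q ^ 2 * ((4 * (J + 1)) ^ (m + 1) * (τ ^ 2 *
          (2 * (2 * m * (e + 1 : ℕ)) ^ m * (M * (D + 1) ^ m : ℕ)))) := by
        gcongr
        exact hτN.trans (by gcongr)
    _ = (J + 1) * (4 * (J + 1)) ^ (m + 1) * (2 * (2 * m * (e + 1 : ℕ)) ^ m) * (q ^ 2 * (τ ^ 2 *
          (G'.card * (M * (D + 1) ^ m : ℕ)))) := by ring
    _ ≤ (J + 1) * (4 * (J + 1)) ^ (m + 1) * (2 * (2 * m * (e + 1 : ℕ)) ^ m) * (q ^ 2 * (τ ^ 2 *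
          (L * q ^ m * ∑ y, ((E y).card : ℝ)))) := by gcongr
    _ = (J + 1) * (4 * (J + 1)) ^ (m + 1) * (2 * (2 * m * (e + 1 : ℕ)) ^ m) * L * q ^ m *
          (q ^ 2 * (τ ^ 2 * ∑ y, ((E y).card : ℝ))) := by ring
    _ ≤ (((e + 1) * (p + 1)) * (4 * ((e + 1) * (p + 1))) ^ (m + 1) *
          (2 * (2 * m * (e + 1 : ℕ)) ^ m) * ((e + 1) * (m * p + 2))) * q ^ m *
          (q ^ (m + 1) * ∑ x, f x ^ 2) := by gcongr
    _ = _ := by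
        push_cast
        rw [show 4 * (((e : ℝ) + 1) * (p + 1)) = (e + 1) * (4 * (p + 1)) by ring,
          mul_pow (e + 1 : ℝ), show 2 * (m : ℝ) * (e + 1) = (e + 1) * (2 * m) by ring,
          mul_pow (e + 1 : ℝ) (2 * m)]
        rw [show 2 * m + 3 = 1 + (m + 1) + m + 1 by ring, pow_add, pow_add, pow_add]
        ring

section cosetAvg
variable {X Y : Type*} [AddCommGroup X] [Fintype X] [AddCommGroup Y] [Fintype Y]

theorem card_mul_sum_comp_of_surjective (ρ : X →+ Y) (hρ : Function.Surjective ρ) (g : Y → ℝ) :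
    (Fintype.card Y : ℝ) * ∑ x, g (ρ x) = Fintype.card X * ∑ y, g y := by
  have h1 : ∑ y, ∑ x, g (y + ρ x) = (Fintype.card Y : ℝ) * ∑ x, g (ρ x) := by
    rw [← nsmul_eq_mul, ← Finset.card_univ, ← Finset.sum_const]
    refine Finset.sum_congr rfl fun y _ => ?_
    obtain ⟨x₀, rfl⟩ := hρ y
    rw [← _root_.Equiv.sum_comp (Equiv.addLeft x₀) fun x => g (ρ x)]
    simp
  rw [← h1, Finset.sum_comm, ← nsmul_eq_mul, ← Finset.card_univ, ← Finset.sum_const]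
  refine Finset.sum_congr rfl fun x _ => ?_
  exact _root_.Equiv.sum_comp (Equiv.addRight (ρ x)) g

/-- The average of `F` over the coset `x + k X`. -/
def cosetAvg (F : X → ℝ) (k : ℕ) (x : X) : ℝ := (∑ z, F (x + k • z)) / Fintype.card X

theorem card_pos_real : (0 : ℝ) < Fintype.card X := by exact_mod_cast Fintype.card_pos_iff.2 ⟨0⟩

theorem cosetAvg_add_nsmul (F : X → ℝ) (k : ℕ) (x w : X) :
    cosetAvg F k (x + k • w) = cosetAvg F k x := by
  unfold cosetAvg
  rw [← _root_.Equiv.sum_comp (Equiv.addLeft w) fun z => F (x + k • z)]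
  simp only [Equiv.coe_addLeft, smul_add, add_assoc]

theorem sum_cosetAvg_mul (F : X → ℝ) (k l : ℕ) (x : X) :
    ∑ w, cosetAvg F (k * l) (x + k • w) = ∑ w, cosetAvg F k (x + k • w) := by
  simp only [cosetAvg_add_nsmul F k]
  unfold cosetAvg
  rw [← Finset.sum_div, Finset.sum_comm, Finset.sum_const, Finset.card_univ, nsmul_eq_mul,
    ← mul_div_assoc]
  congr 1
  rw [← nsmul_eq_mul, ← Finset.card_univ, ← Finset.sum_const]
  refine Finset.sum_congr rfl fun z _ => ?_
  rw [← _root_.Equiv.sum_comp (Equiv.addRight (l • z)) fun w => F (x + k • w)]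
  simp only [Equiv.coe_addRight, smul_add, add_assoc, mul_smul]

theorem sum_cosetAvg (F : X → ℝ) (k : ℕ) : ∑ x, cosetAvg F k x = ∑ x, F x := by
  unfold cosetAvg
  rw [← Finset.sum_div, Finset.sum_comm, div_eq_iff card_pos_real.ne', mul_comm, ← nsmul_eq_mul,
    ← Finset.card_univ, ← Finset.sum_const]
  exact Finset.sum_congr rfl fun z _ => _root_.Equiv.sum_comp (Equiv.addRight (k • z)) F

theorem cosetAvg_nonneg {F : X → ℝ} (hF : ∀ x, 0 ≤ F x) (k : ℕ) (x : X) : 0 ≤ cosetAvg F k x :=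
  div_nonneg (Finset.sum_nonneg fun _ _ => hF _) card_pos_real.le

theorem cosetAvg_le_one {F : X → ℝ} (hF : ∀ x, F x ≤ 1) (k : ℕ) (x : X) : cosetAvg F k x ≤ 1 := by
  rw [cosetAvg, div_le_one card_pos_real]
  calc ∑ z, F (x + k • z) ≤ ∑ z : X, (1 : ℝ) := Finset.sum_le_sum fun z _ => hF _
    _ = _ := by simp

theorem cosetAvg_one (F : X → ℝ) (x : X) : cosetAvg F 1 x = (∑ z, F z) / Fintype.card X := by
  unfold cosetAvg
  congr 1
  simp only [one_smul]
  exact _root_.Equiv.sum_comp (Equiv.addLeft x) F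

theorem cosetAvg_of_nsmul_eq_zero (F : X → ℝ) {k : ℕ} (hk : ∀ z : X, k • z = 0) (x : X) :
    cosetAvg F k x = F x := by
  unfold cosetAvg
  simp [hk, card_pos_real.ne']

/-- The martingale difference between the scales `k` and `k * l` descends to the quotient by
`(k * l) X`; it has mean zero on the cosets of `k` and its `L²` norm is controlled by the mean of
`F`. -/
theorem exists_descend_cosetAvg_sub {F : X → ℝ} (hF0 : ∀ x, 0 ≤ F x) (hF1 : ∀ x, F x ≤ 1)
    (k l : ℕ) (ρ : X →+ Y) (hρ : Function.Surjective ρ)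
    (hker : ∀ x, ρ x = 0 → ∃ z, x = (k * l) • z) :
    ∃ f : Y → ℝ, (∀ x, f (ρ x) = cosetAvg F (k * l) x - cosetAvg F k x) ∧ (∀ y, f y ≤ 1) ∧
      (∀ y, ∑ z, f (y + k • z) = 0) ∧
      Fintype.card X * ∑ y, f y ^ 2 ≤ 2 * Fintype.card Y * ∑ x, F x := by
  let g : X → ℝ := fun x => cosetAvg F (k * l) x - cosetAvg F k x
  have hg : ∀ x x', ρ x = ρ x' → g x = g x' := by
    intro x x' h
    obtain ⟨z, hz⟩ := hker (x - x') (by rw [map_sub, h, sub_self])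
    obtain rfl : x = x' + (k * l) • z := by rw [← hz]; abel
    simp only [g]
    rw [cosetAvg_add_nsmul, mul_smul, cosetAvg_add_nsmul]
  have hfg : ∀ x, g (Function.surjInv hρ (ρ x)) = g x := fun x =>
    hg _ _ (Function.surjInv_eq hρ _)
  refine ⟨fun y => g (Function.surjInv hρ y), hfg, fun y => ?_, fun y => ?_, ?_⟩
  · have h1 := cosetAvg_le_one hF1 (k * l) (Function.surjInv hρ y)
    have h2 := cosetAvg_nonneg hF0 k (Function.surjInv hρ y)
    simp only [g]; linarith
  · obtain ⟨x, rfl⟩ := hρ y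
    have h1 := card_mul_sum_comp_of_surjective ρ hρ fun z => g (Function.surjInv hρ (ρ x + k • z))
    simp only [← map_nsmul, ← map_add, hfg] at h1
    simp only [g, Finset.sum_sub_distrib, sum_cosetAvg_mul, sub_self, mul_zero] at h1 ⊢
    exact (mul_eq_zero.1 h1.symm).resolve_left card_pos_real.ne'
  · have h1 := card_mul_sum_comp_of_surjective ρ hρ fun y => g (Function.surjInv hρ y) ^ 2
    simp only [hfg] at h1
    rw [← h1, mul_comm 2, mul_assoc]
    refine mul_le_mul_of_nonneg_left ?_ card_pos_real.le
    calc ∑ x, g x ^ 2 ≤ ∑ x, (cosetAvg F (k * l) x + cosetAvg F k x) := by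
          refine Finset.sum_le_sum fun x _ => ?_
          have h1 := cosetAvg_le_one hF1 (k * l) x
          have h2 := cosetAvg_nonneg hF0 k x
          have h3 := cosetAvg_le_one hF1 k x
          have h4 := cosetAvg_nonneg hF0 (k * l) x
          simp only [g]
          nlinarith
      _ = _ := by rw [Finset.sum_add_distrib, sum_cosetAvg, sum_cosetAvg]; ring

end cosetAvg

theorem ZMod.exists_eq_nsmul_of_castHom_eq_zero {a b : ℕ} [NeZero b] (h : a ∣ b) (x : ZMod b)
    (hx : ZMod.castHom h (ZMod a) x = 0) : ∃ z : ZMod b, x = a • z := by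
  rw [← ZMod.natCast_zmod_val x, map_natCast, ZMod.natCast_eq_zero_iff] at hx
  obtain ⟨c, hc⟩ := hx
  exact ⟨c, by rw [← ZMod.natCast_zmod_val x, hc, Nat.cast_mul, nsmul_eq_mul]⟩

section reduction
variable {R R' : Type*} [CommRing R] [CommRing R']

/-- Coordinatewise reduction. -/
def redHom (φ : R →+* R') (m : ℕ) : R × R × (Fin m → R) →+ R' × R' × (Fin m → R') :=
  φ.toAddMonoidHom.prodMap (φ.toAddMonoidHom.prodMap (φ.toAddMonoidHom.compLeft (Fin m)))

theorem redHom_apply (φ : R →+* R') (m : ℕ) (x : R × R × (Fin m → R)) :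
    redHom φ m x = (φ x.1, φ x.2.1, fun i => φ (x.2.2 i)) := rfl

theorem redHom_surjective {φ : R →+* R'} (hφ : Function.Surjective φ) (m : ℕ) :
    Function.Surjective (redHom φ m) := by
  rintro ⟨a, b, c⟩
  obtain ⟨a, rfl⟩ := hφ a
  obtain ⟨b, rfl⟩ := hφ b
  choose d hd using fun i => hφ (c i)
  exact ⟨(a, b, d), by rw [redHom_apply]; simp only [hd]⟩

theorem exists_eq_nsmul_of_redHom_eq_zero {φ : R →+* R'} {k : ℕ}
    (hφ : ∀ x, φ x = 0 → ∃ z, x = k • z) (m : ℕ) (x : R × R × (Fin m → R))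
    (hx : redHom φ m x = 0) : ∃ z, x = k • z := by
  rw [redHom_apply] at hx
  simp only [Prod.ext_iff, Prod.fst_zero, Prod.snd_zero, funext_iff, Pi.zero_apply] at hx
  obtain ⟨a, ha⟩ := hφ _ hx.1
  obtain ⟨b, hb⟩ := hφ _ hx.2.1
  choose c hc using fun i => hφ _ (hx.2.2 i)
  exact ⟨(a, b, c), Prod.ext ha (Prod.ext hb (funext hc))⟩

/-- Reduction of the parameters of a family of planes. -/
def redDir (φ : R →+* R') (m : ℕ) :
    (R × (Fin m → R)) × (Fin m → R) →+ (R' × (Fin m → R')) × (Fin m → R') :=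
  (φ.toAddMonoidHom.prodMap (φ.toAddMonoidHom.compLeft (Fin m))).prodMap
    (φ.toAddMonoidHom.compLeft (Fin m))

theorem redDir_apply (φ : R →+* R') (m : ℕ) (x : (R × (Fin m → R)) × (Fin m → R)) :
    redDir φ m x = ((φ x.1.1, fun i => φ (x.1.2 i)), fun i => φ (x.2 i)) := rfl

theorem redDir_surjective {φ : R →+* R'} (hφ : Function.Surjective φ) (m : ℕ) :
    Function.Surjective (redDir φ m) := by
  rintro ⟨⟨a, c⟩, c'⟩
  obtain ⟨a, rfl⟩ := hφ a
  choose d hd using fun i => hφ (c i)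
  choose d' hd' using fun i => hφ (c' i)
  exact ⟨((a, d), d'), by rw [redDir_apply]; simp only [hd, hd']⟩

/-- The plane through `a` spanned by `(1, y)` and `(0, 1, b)`, where `g = (y, b)`. -/
def planePt {m : ℕ} (a : R × R × (Fin m → R)) (g : (R × (Fin m → R)) × (Fin m → R)) (s t : R) :
    R × R × (Fin m → R) :=
  a + s • (1, g.1) + t • (0, 1, g.2)

theorem redHom_planePt (φ : R →+* R') {m : ℕ} (a : R × R × (Fin m → R))
    (g : (R × (Fin m → R)) × (Fin m → R)) (s t : R) :
    redHom φ m (planePt a g s t) = planePt (redHom φ m a) (redDir φ m g) (φ s) (φ t) := by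
  refine Prod.ext ?_ (Prod.ext ?_ (funext fun i => ?_)) <;>
    simp [planePt, redHom_apply, redDir_apply]

theorem sum_planePt_comp [Fintype R] [Fintype R'] {φ : R →+* R'} (hφ : Function.Surjective φ)
    {m : ℕ} (f : R' × R' × (Fin m → R') → ℝ) (a : R × R × (Fin m → R))
    (g : (R × (Fin m → R)) × (Fin m → R)) :
    (Fintype.card R' : ℝ) ^ 2 * ∑ s, ∑ t, f (redHom φ m (planePt a g s t)) =
      (Fintype.card R : ℝ) ^ 2 * ∑ s, ∑ t, f (planePt (redHom φ m a) (redDir φ m g) s t) := by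
  simp only [redHom_planePt]
  have h1 : ∀ s, (Fintype.card R' : ℝ) * ∑ t, f (planePt (redHom φ m a) (redDir φ m g) s (φ t)) =
      Fintype.card R * ∑ t, f (planePt (redHom φ m a) (redDir φ m g) s t) := fun s =>
    card_mul_sum_comp_of_surjective φ.toAddMonoidHom hφ
      fun t => f (planePt (redHom φ m a) (redDir φ m g) s t)
  have h2 := card_mul_sum_comp_of_surjective φ.toAddMonoidHom hφ
      fun s => ∑ t, f (planePt (redHom φ m a) (redDir φ m g) s t)
  simp only [RingHom.toAddMonoidHom_eq_coe, AddMonoidHom.coe_coe] at h2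
  rw [sq, mul_assoc, Finset.mul_sum, Finset.sum_congr rfl fun s _ => h1 (φ s), ← Finset.mul_sum]
  linear_combination (Fintype.card R : ℝ) * h2

end reduction

theorem exists_le_of_sum_weights {K : ℕ} {v : ℝ} (hv : 0 < v) (P : ℕ → ℝ)
    (h : v ≤ ∑ e ∈ Finset.range K, P e) :
    ∃ e < K, v * (1 / ((e + 1) * (e + 2))) ≤ P e := by
  have hw : ∀ K : ℕ, ∑ e ∈ Finset.range K, (1 / (((e : ℝ) + 1) * (e + 2))) = 1 - 1 / (K + 1) := by
    intro K
    induction K with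
    | zero => simp
    | succ K ih => rw [Finset.sum_range_succ, ih]; push_cast; field_simp; ring
  by_contra! hcon
  have h1 : ∑ e ∈ Finset.range K, P e ≤ ∑ e ∈ Finset.range K, v * (1 / (((e : ℝ) + 1) * (e + 2))) :=
    Finset.sum_le_sum fun e he => (hcon e (Finset.mem_range.1 he)).le
  rw [← Finset.mul_sum, hw] at h1
  have : 0 < v * (1 / ((K : ℝ) + 1)) := by positivity
  linarith

theorem exists_pow_le_const_mul_pow (p A : ℕ) (hp : 1 < p) :
    ∃ C : ℝ, 0 < C ∧ ∀ e : ℕ, ((e : ℝ) + 2) ^ A ≤ C * (p : ℝ) ^ (e + 1) := by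
  have h := tendsto_pow_const_div_const_pow_of_one_lt A (r := (p : ℝ)) (by exact_mod_cast hp)
  obtain ⟨B, hB⟩ := h.bddAbove_range
  have hp0 : (0 : ℝ) < p := by exact_mod_cast (by omega : 0 < p)
  have hB' : ∀ n : ℕ, (n : ℝ) ^ A ≤ B * (p : ℝ) ^ n := fun n => by
    have := hB ⟨n, rfl⟩
    rwa [div_le_iff₀ (by positivity)] at this
  have hB0 : 0 < B := by
    have := hB' 1
    simp at this
    exact pos_of_mul_pos_left (lt_of_lt_of_le one_pos this) hp0.le
  refine ⟨B * p, by positivity, fun e => ?_⟩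
  have := hB' (e + 2)
  push_cast at this
  linarith [this, (by ring : B * (p : ℝ) ^ (e + 2) = B * p * (p : ℝ) ^ (e + 1))]

/-- The uniform estimate at finite level. -/
theorem exists_le_card_of_planes (p : ℕ) [hp : Fact p.Prime] (m : ℕ) (hm : 1 ≤ m) :
    ∃ C : ℝ, 0 < C ∧ ∀ (K : ℕ)
      (S : Finset (ZMod (p ^ K) × ZMod (p ^ K) × (Fin m → ZMod (p ^ K)))) (v : ℝ), 0 < v → v ≤ 1 →
      (∀ g : (ZMod (p ^ K) × (Fin m → ZMod (p ^ K))) × (Fin m → ZMod (p ^ K)),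
        ∃ a, v * ((p : ℝ) ^ K) ^ 2 ≤
        ∑ s : ZMod (p ^ K), ∑ t : ZMod (p ^ K), if planePt a g s t ∈ S then 1 else 0) →
      C * v ^ (m + 1) * ((p : ℝ) ^ K) ^ (m + 2) ≤ S.card := by
  classical
  obtain ⟨C₀, hC₀, hpow⟩ := exists_pow_le_const_mul_pow p (4 * m + 7) hp.out.one_lt
  obtain ⟨C₁, hC₁⟩ : ∃ C₁ : ℝ, C₁ = (p + 1) * (4 * (p + 1)) ^ (m + 1) * (2 * (2 * m) ^ m) *
    (m * p + 2) := ⟨_, rfl⟩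
  have hp0 : (0 : ℝ) < p := by exact_mod_cast hp.out.pos
  have hC₁0 : 0 < C₁ := by rw [hC₁]; positivity
  refine ⟨min (1 / 2) (1 / (C₁ * 2 ^ (m + 2) * C₀)), by positivity, ?_⟩
  intro K S v hv hv1 hS
  have hcard : (Fintype.card (ZMod (p ^ K)) : ℝ) = (p : ℝ) ^ K := by rw [ZMod.card]; push_cast; rfl
  have hcardX : (Fintype.card (ZMod (p ^ K) × ZMod (p ^ K) × (Fin m → ZMod (p ^ K))) : ℝ) =
      ((p : ℝ) ^ K) ^ (m + 2) := by
    simp only [Fintype.card_prod, Fintype.card_fun, Fintype.card_fin, Nat.cast_mul, Nat.cast_pow,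
      hcard]
    ring
  obtain ⟨F, hF⟩ : ∃ F : ZMod (p ^ K) × ZMod (p ^ K) × (Fin m → ZMod (p ^ K)) → ℝ,
    F = fun x => if x ∈ S then 1 else 0 := ⟨_, rfl⟩
  have hF0 : ∀ x, 0 ≤ F x := fun x => by
    simp only [hF]; split_ifs <;> norm_num
  have hF1 : ∀ x, F x ≤ 1 := fun x => by
    simp only [hF]; split_ifs <;> norm_num
  have hFS : ∑ x, F x = S.card := by
    simp [hF]
  replace hS : ∀ g : (ZMod (p ^ K) × (Fin m → ZMod (p ^ K))) × (Fin m → ZMod (p ^ K)),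
      ∃ a, v * ((p : ℝ) ^ K) ^ 2 ≤ ∑ s, ∑ t, F (planePt a g s t) := by rw [hF]; exact hS
  obtain ⟨Q, hQ⟩ : ∃ Q : ℝ, Q = (p : ℝ) ^ K := ⟨_, rfl⟩
  have hQ0 : 0 < Q := by rw [hQ]; positivity
  rw [← hQ] at hS hcard hcardX ⊢
  obtain ⟨σ, hσ⟩ : ∃ σ : ℝ, σ = S.card / Q ^ (m + 2) := ⟨_, rfl⟩
  have hσ0 : 0 ≤ σ := by rw [hσ]; positivity
  have hSσ : (S.card : ℝ) = σ * Q ^ (m + 2) := by rw [hσ]; field_simp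
  suffices h : min (1 / 2) (1 / (C₁ * 2 ^ (m + 2) * C₀)) * v ^ (m + 1) ≤ σ by
    rw [hSσ]; gcongr
  rcases le_or_gt (v / 2) σ with h | hlt
  · have : v ^ (m + 1) ≤ v := pow_le_of_le_one hv.le hv1 (by omega)
    calc min (1 / 2) (1 / (C₁ * 2 ^ (m + 2) * C₀)) * v ^ (m + 1) ≤ 1 / 2 * v := by
          gcongr; exact min_le_left _ _
      _ ≤ σ := by linarith
  choose a ha using hS
  let D : ℕ → ZMod (p ^ K) × ZMod (p ^ K) × (Fin m → ZMod (p ^ K)) → ℝ := fun e x =>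
    cosetAvg F (p ^ e * p) x - cosetAvg F (p ^ e) x
  let P : ℕ → (ZMod (p ^ K) × (Fin m → ZMod (p ^ K))) × (Fin m → ZMod (p ^ K)) → ℝ := fun e g =>
    (∑ s, ∑ t, D e (planePt (a g) g s t)) / Q ^ 2
  have htel : ∀ x, ∑ e ∈ Finset.range K, D e x = F x - σ := by
    intro x
    have h1 := Finset.sum_range_sub (fun e => cosetAvg F (p ^ e) x) K
    simp only [pow_succ] at h1
    simp only [D]
    rw [h1, pow_zero, cosetAvg_one, hFS, hcardX, hσ, cosetAvg_of_nsmul_eq_zero]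
    intro z
    have h0 : ((p ^ K : ℕ) : ZMod (p ^ K)) = 0 := ZMod.natCast_self _
    have h0' : ((p ^ K : ℕ) : ZMod (p ^ K) × ZMod (p ^ K) × (Fin m → ZMod (p ^ K))) = 0 :=
      Prod.ext h0 (Prod.ext h0 (funext fun _ => h0))
    rw [nsmul_eq_mul, h0', zero_mul]
  have hP : ∀ g, v / 2 ≤ ∑ e ∈ Finset.range K, P e g := by
    intro g
    simp only [P]
    rw [← Finset.sum_div, Finset.sum_comm, Finset.sum_congr rfl fun s _ => Finset.sum_comm]
    simp only [htel, Finset.sum_sub_distrib, Finset.sum_const, Finset.card_univ, nsmul_eq_mul,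
      hcard]
    rw [le_div_iff₀ (by positivity)]
    have := ha g
    nlinarith [mul_pos hQ0 hQ0]
  have hex : ∀ g, ∃ e ∈ Finset.range K, v / 2 * (1 / ((e + 1) * (e + 2))) ≤ P e g := by
    intro g
    obtain ⟨e, he, h⟩ := exists_le_of_sum_weights (by positivity) (fun e => P e g) (hP g)
    exact ⟨e, Finset.mem_range.2 he, h⟩
  choose ε hεK hε using hex
  obtain ⟨Γ, hΓ⟩ : ∃ Γ : ℝ,
    Γ = Fintype.card ((ZMod (p ^ K) × (Fin m → ZMod (p ^ K))) × (Fin m → ZMod (p ^ K))) :=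
    ⟨_, rfl⟩
  have hΓ0 : 0 < Γ := by rw [hΓ]; exact card_pos_real
  obtain ⟨e, heK, he⟩ := exists_le_of_sum_weights hΓ0
    (fun e => ((Finset.univ.filter fun g => ε g = e).card : ℝ)) (K := K) (by
      rw [hΓ, ← Finset.card_univ]
      exact_mod_cast (Finset.card_eq_sum_card_fiberwise (f := ε) (t := Finset.range K)
        (fun g _ => Finset.mem_coe.2 (hεK g))).le)
  obtain ⟨w, hw⟩ : ∃ w : ℝ, w = 1 / (((e : ℝ) + 1) * (e + 2)) := ⟨_, rfl⟩
  have hw0 : 0 < w := by rw [hw]; positivity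
  rw [← hw] at he
  have hdvd : p ^ (e + 1) ∣ p ^ K := pow_dvd_pow p heK
  obtain ⟨φ, hφ⟩ : ∃ φ, φ = ZMod.castHom hdvd (ZMod (p ^ (e + 1))) := ⟨_, rfl⟩
  have hφs : Function.Surjective φ := ZMod.ringHom_surjective φ
  obtain ⟨f, hfD, hf1, hf0, hf2⟩ := exists_descend_cosetAvg_sub hF0 hF1 (p ^ e) p (redHom φ m)
    (redHom_surjective hφs m) (exists_eq_nsmul_of_redHom_eq_zero (fun x hx => by
      rw [← pow_succ]; rw [hφ] at hx; exact ZMod.exists_eq_nsmul_of_castHom_eq_zero hdvd x hx) m)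
  obtain ⟨q, hq⟩ : ∃ q : ℝ, q = (p : ℝ) ^ (e + 1) := ⟨_, rfl⟩
  have hq0 : 0 < q := by rw [hq]; positivity
  have hcardq : (Fintype.card (ZMod (p ^ (e + 1))) : ℝ) = q := by
    rw [ZMod.card, hq]; push_cast; rfl
  have hcardY : (Fintype.card (ZMod (p ^ (e + 1)) × ZMod (p ^ (e + 1)) ×
      (Fin m → ZMod (p ^ (e + 1)))) : ℝ) = q ^ (m + 2) := by
    simp only [Fintype.card_prod, Fintype.card_fun, Fintype.card_fin, Nat.cast_mul, Nat.cast_pow,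
      hcardq]
    ring
  let G := (Finset.univ.filter fun g => ε g = e).image (redDir φ m)
  have hG : ∀ g ∈ G, ∃ a, v / 2 * w * q ^ 2 ≤
      ∑ s : ZMod (p ^ (e + 1)), ∑ t : ZMod (p ^ (e + 1)), f (a + s • (1, g.1) + t • (0, 1, g.2)) := by
    intro g' hg'
    obtain ⟨g, hg, rfl⟩ := Finset.mem_image.1 hg'
    refine ⟨redHom φ m (a g), ?_⟩
    have h1 := sum_planePt_comp hφs f (a g) g
    have h2 := hε g
    simp only [hfD, hcard, hcardq] at h1
    rw [(Finset.mem_filter.1 hg).2, ← hw] at h2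
    simp only [P] at h2
    rw [le_div_iff₀ (by positivity)] at h2
    refine le_of_mul_le_mul_left ?_ (show 0 < Q ^ 2 by positivity)
    change _ ≤ Q ^ 2 * ∑ s, ∑ t, f (planePt (redHom φ m (a g)) (redDir φ m g) s t)
    rw [← h1]
    have h3 := mul_le_mul_of_nonneg_left h2 (show 0 ≤ q ^ 2 by positivity)
    simp only [D] at h3
    linarith
  have hGcard : w * q ^ (2 * m + 1) ≤ G.card := by
    have h1 := card_mul_sum_comp_of_surjective (redDir φ m) (redDir_surjective hφs m)
      (fun y => if y ∈ G then (1 : ℝ) else 0)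
    have h2 : ∑ y, (if y ∈ G then (1 : ℝ) else 0) = G.card := by
      simp
    have h3 : ((Finset.univ.filter fun g => ε g = e).card : ℝ) ≤
        ∑ x, (if redDir φ m x ∈ G then (1 : ℝ) else 0) := by
      rw [Finset.card_eq_sum_ones, Nat.cast_sum, Finset.sum_filter]
      refine Finset.sum_le_sum fun g _ => ?_
      by_cases hg : ε g = e
      · rw [if_pos hg, if_pos (Finset.mem_image_of_mem _ (by simpa using hg)), Nat.cast_one]
      · rw [if_neg hg]; split_ifs <;> simp
    have h4 : (Fintype.card ((ZMod (p ^ (e + 1)) × (Fin m → ZMod (p ^ (e + 1)))) ×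
        (Fin m → ZMod (p ^ (e + 1)))) : ℝ) = q ^ (2 * m + 1) := by
      simp only [Fintype.card_prod, Fintype.card_fun, Fintype.card_fin, Nat.cast_mul, Nat.cast_pow,
        hcardq]
      ring
    rw [h4, h2, ← hΓ] at h1
    have h5 := mul_le_mul_of_nonneg_left (he.trans h3) (show 0 ≤ q ^ (2 * m + 1) by positivity)
    rw [h1] at h5
    refine le_of_mul_le_mul_left ?_ hΓ0
    linarith
  have hkey := card_mul_le_sum_sq_of_planes p hm f hf1 (fun x => by
    have := hf0 x
    simpa only [← Nat.cast_pow, Nat.cast_smul_eq_nsmul] using this)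
    (show 0 < v / 2 * w by positivity) G (by rw [← hq]; exact hG)
  rw [← hq, ← hC₁] at hkey
  rw [hcardX, hcardY, hFS, hSσ] at hf2
  have hf2' : ∑ y, f y ^ 2 ≤ 2 * q ^ (m + 2) * σ := by
    refine le_of_mul_le_mul_left ?_ (show 0 < Q ^ (m + 2) by positivity)
    linarith
  have hmain : v ^ (m + 1) * (w ^ (m + 2) * q) ≤ C₁ * 2 ^ (m + 2) * (e + 1 : ℝ) ^ (2 * m + 3) * σ := by
    have h1 : (w * q ^ (2 * m + 1)) * (v / 2 * w) ^ (m + 1) * q ^ 2 ≤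
        C₁ * (e + 1 : ℝ) ^ (2 * m + 3) * (q ^ m * (2 * q ^ (m + 2) * σ)) :=
      le_trans (by gcongr) (hkey.trans (by gcongr))
    refine le_of_mul_le_mul_right ?_ (show 0 < q ^ (2 * m + 2) / 2 ^ (m + 1) by positivity)
    calc v ^ (m + 1) * (w ^ (m + 2) * q) * (q ^ (2 * m + 2) / 2 ^ (m + 1)) =
          (w * q ^ (2 * m + 1)) * (v / 2 * w) ^ (m + 1) * q ^ 2 := by
          rw [mul_pow, div_pow]; ring
      _ ≤ _ := h1
      _ = _ := by
        rw [pow_succ 2 (m + 1)]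
        field_simp
        ring
  have hwle : 1 ≤ w * (e + 2 : ℝ) ^ 2 := by
    rw [hw, one_div, inv_mul_eq_div, le_div_iff₀ (by positivity)]
    nlinarith [(Nat.cast_nonneg e : (0 : ℝ) ≤ e)]
  have hwq : 1 * (e + 2 : ℝ) ^ (4 * m + 7) ≤ w ^ (m + 2) * (e + 2 : ℝ) ^ (2 * m + 4) * (C₀ * q) := by
    have h1 : (1 : ℝ) ≤ w ^ (m + 2) * (e + 2 : ℝ) ^ (2 * m + 4) := by
      have := one_le_pow₀ hwle (n := m + 2)
      rwa [mul_pow, ← pow_mul, show 2 * (m + 2) = 2 * m + 4 by ring] at this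
    rw [hq]
    exact mul_le_mul h1 (hpow e) (by positivity) (by positivity)
  have hfin : v ^ (m + 1) ≤ C₁ * 2 ^ (m + 2) * C₀ * σ := by
    refine le_of_mul_le_mul_right ?_ (show (0 : ℝ) < (e + 2 : ℝ) ^ (4 * m + 7) by positivity)
    calc v ^ (m + 1) * (e + 2 : ℝ) ^ (4 * m + 7)
        ≤ v ^ (m + 1) * (w ^ (m + 2) * (e + 2 : ℝ) ^ (2 * m + 4) * (C₀ * q)) := by
          rw [one_mul] at hwq; gcongr
      _ = C₀ * (e + 2 : ℝ) ^ (2 * m + 4) * (v ^ (m + 1) * (w ^ (m + 2) * q)) := by ring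
      _ ≤ C₀ * (e + 2 : ℝ) ^ (2 * m + 4) * (C₁ * 2 ^ (m + 2) * (e + 2 : ℝ) ^ (2 * m + 3) * σ) := by
          refine mul_le_mul_of_nonneg_left (hmain.trans ?_) (by positivity)
          gcongr
          norm_num
      _ = _ := by
          rw [show 4 * m + 7 = (2 * m + 4) + (2 * m + 3) by ring, pow_add]; ring
  calc min (1 / 2) (1 / (C₁ * 2 ^ (m + 2) * C₀)) * v ^ (m + 1)
      ≤ 1 / (C₁ * 2 ^ (m + 2) * C₀) * v ^ (m + 1) := by gcongr; exact min_le_right _ _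
    _ ≤ σ := by
      rw [one_div, inv_mul_eq_div, div_le_iff₀ (by positivity)]
      linarith

theorem measure_preimage_eq_card_div {A B : Type*} [AddGroup A] [MeasurableSpace A]
    [MeasurableAdd A] [AddGroup B] [Fintype B] (μ : Measure A) [IsProbabilityMeasure μ]
    [μ.IsAddLeftInvariant] (ρ : A →+ B) (hρ : Function.Surjective ρ)
    (hm : ∀ b, MeasurableSet (ρ ⁻¹' {b})) (T : Finset B) :
    μ (ρ ⁻¹' T) = (T.card : ℝ≥0∞) / Fintype.card B := by
  have h1 : ∀ b, μ (ρ ⁻¹' {b}) = μ (ρ ⁻¹' {0}) := by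
    intro b
    obtain ⟨a, rfl⟩ := hρ b
    rw [← measure_preimage_add μ a (ρ ⁻¹' {ρ a})]
    congr 1
    ext x
    simp
  have h2 : ∀ T : Finset B, μ (ρ ⁻¹' T) = T.card * μ (ρ ⁻¹' {0}) := by
    intro T
    have : ρ ⁻¹' (T : Set B) = ⋃ b ∈ T, ρ ⁻¹' {b} := by ext; simp
    rw [this, measure_biUnion_finset _ (fun b _ => hm b)]
    · simp [h1]
    · intro b _ c _ hbc
      exact Disjoint.preimage _ (by simpa using hbc)
  have h3 := h2 Finset.univ
  have : Nonempty B := ⟨0⟩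
  rw [Finset.coe_univ, Set.preimage_univ, measure_univ, Finset.card_univ] at h3
  rw [h2, ENNReal.div_eq_inv_mul, mul_comm]
  congr 1
  exact ENNReal.eq_inv_of_mul_eq_one_left (by rw [mul_comm]; exact h3.symm)

theorem PadicInt.toZModPow_eq_iff_norm_sub_le {p : ℕ} [Fact p.Prime] (k : ℕ) (x y : ℤ_[p]) :
    PadicInt.toZModPow k x = PadicInt.toZModPow k y ↔ ‖x - y‖ ≤ (p : ℝ) ^ (-k : ℤ) := by
  rw [PadicInt.norm_le_pow_iff_mem_span_pow, ← PadicInt.ker_toZModPow, RingHom.mem_ker, map_sub,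
    sub_eq_zero]

theorem PadicInt.continuous_toZModPow {p : ℕ} [hp : Fact p.Prime] (k : ℕ) :
    Continuous (PadicInt.toZModPow k : ℤ_[p] → ZMod (p ^ k)) := by
  have hpos : (0 : ℝ) < (p : ℝ) ^ (-k : ℤ) := zpow_pos (by exact_mod_cast hp.out.pos) _
  rw [continuous_iff_continuousAt]
  intro x
  rw [ContinuousAt, nhds_discrete (ZMod (p ^ k)), Filter.tendsto_pure]
  filter_upwards [Metric.closedBall_mem_nhds x hpos] with y hy
  rw [PadicInt.toZModPow_eq_iff_norm_sub_le]
  simpa [dist_eq_norm] using hy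

section
variable (p : ℕ) [hp : Fact p.Prime]

/-- Coordinatewise reduction modulo `p ^ k`. -/
def redPi (k : ℕ) (ι : Type*) : (ι → ℤ_[p]) →+ (ι → ZMod (p ^ k)) :=
  (PadicInt.toZModPow (p := p) k).toAddMonoidHom.compLeft ι

theorem redPi_apply (k : ℕ) {ι : Type*} (x : ι → ℤ_[p]) (i : ι) :
    redPi p k ι x i = PadicInt.toZModPow k (x i) := rfl

theorem redPi_surjective (k : ℕ) (ι : Type*) : Function.Surjective (redPi p k ι) := by
  intro b
  choose x hx using fun i => ZMod.ringHom_surjective (PadicInt.toZModPow (p := p) k) (b i)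
  exact ⟨x, funext hx⟩

theorem continuous_redPi (k : ℕ) (ι : Type*) : Continuous (redPi p k ι) :=
  continuous_pi fun i => (PadicInt.continuous_toZModPow k).comp (continuous_apply i)

instance (n : ℕ) : (padicHaar p n).IsAddHaarMeasure := by
  unfold padicHaar; infer_instance

instance (n : ℕ) : (padicHaar p n).Regular := by
  unfold padicHaar; infer_instance

instance (n : ℕ) : IsProbabilityMeasure (padicHaar p n) :=
  ⟨by unfold padicHaar; exact Measure.addHaarMeasure_self⟩

theorem padicHaar_preimage_redPi (k n : ℕ) (T : Finset (Fin n → ZMod (p ^ k))) :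
    padicHaar p n (redPi p k (Fin n) ⁻¹' T) = ENNReal.ofReal (T.card / ((p : ℝ) ^ k) ^ n) := by
  have hp0 : (0 : ℝ) < p := by exact_mod_cast hp.out.pos
  rw [measure_preimage_eq_card_div _ _ (redPi_surjective p k _)
    (fun b => ((isOpen_discrete {b}).preimage (continuous_redPi p k _)).measurableSet),
    ENNReal.ofReal_div_of_pos (by positivity), ENNReal.ofReal_natCast]
  congr 1
  rw [Fintype.card_fun, Fintype.card_fin, ZMod.card, ← Nat.cast_pow, ← Nat.cast_pow,
    ENNReal.ofReal_natCast]

variable {p}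

/-- The union of the cosets of `p ^ k` contained in `V`. -/
def cosetInterior {ι : Type*} (V : Set (ι → ℤ_[p])) (k : ℕ) : Set (ι → ℤ_[p]) :=
  {x | ∀ x', redPi p k ι x' = redPi p k ι x → x' ∈ V}

theorem cosetInterior_subset {ι : Type*} (V : Set (ι → ℤ_[p])) (k : ℕ) : cosetInterior V k ⊆ V :=
  fun x hx => hx x rfl

theorem monotone_cosetInterior {ι : Type*} (V : Set (ι → ℤ_[p])) : Monotone (cosetInterior V) := by
  intro k l hkl x hx x' h
  refine hx x' (funext fun i => ?_)
  have h1 := congrFun h i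
  rw [redPi_apply, redPi_apply] at h1 ⊢
  rw [← PadicInt.cast_toZModPow k l hkl, h1, PadicInt.cast_toZModPow k l hkl]

theorem iUnion_cosetInterior {ι : Type*} [Fintype ι] {V : Set (ι → ℤ_[p])} (hV : IsOpen V) :
    ⋃ k, cosetInterior V k = V := by
  refine Set.Subset.antisymm (Set.iUnion_subset fun k => cosetInterior_subset V k) fun x hx => ?_
  obtain ⟨ε, hε, hball⟩ := Metric.isOpen_iff.1 hV x hx
  obtain ⟨k, hk⟩ := PadicInt.exists_pow_neg_lt p hε
  refine Set.mem_iUnion.2 ⟨k, fun x' h => hball ?_⟩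
  rw [Metric.mem_ball]
  refine lt_of_le_of_lt ((dist_pi_le_iff (by positivity)).2 fun i => ?_) hk
  rw [dist_eq_norm, ← PadicInt.toZModPow_eq_iff_norm_sub_le]
  exact congrFun h i

end

section
variable {R : Type*}

/-- Concatenation of coordinates. -/
def consPt {m : ℕ} (x : R × R × (Fin m → R)) : Fin (m + 2) → R :=
  Fin.cons x.1 (Fin.cons x.2.1 x.2.2)

theorem consPt_bijective (m : ℕ) : Function.Bijective (consPt : R × R × (Fin m → R) → _) := by
  constructor
  · rintro ⟨a, b, c⟩ ⟨a', b', c'⟩ h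
    obtain ⟨h1, h2⟩ := Fin.cons_inj.1 h
    obtain ⟨h2, h3⟩ := Fin.cons_inj.1 h2
    exact Prod.ext h1 (Prod.ext h2 h3)
  · intro x
    exact ⟨(x 0, x 1, fun i => x i.succ.succ), funext fun i => by
      refine Fin.cases rfl (fun i => ?_) i
      exact Fin.cases rfl (fun i => rfl) i⟩

theorem consPt_planePt [CommRing R] {m : ℕ} (a : R × R × (Fin m → R))
    (g : (R × (Fin m → R)) × (Fin m → R)) (s t : R) :
    (fun j => consPt a j + s * consPt (1, g.1) j + t * consPt (0, 1, g.2) j) =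
      consPt (planePt a g s t) := by
  refine funext fun i => Fin.cases ?_ (fun i => Fin.cases ?_ (fun i => ?_) i) i <;>
    simp [consPt, planePt]

end

theorem redPi_consPt (p : ℕ) [Fact p.Prime] (k : ℕ) {m : ℕ} (x : ℤ_[p] × ℤ_[p] × (Fin m → ℤ_[p])) :
    redPi p k _ (consPt x) = consPt (redHom (PadicInt.toZModPow k) m x) :=
  funext fun i => Fin.cases rfl (fun i => Fin.cases rfl (fun _ => rfl) i) i

section
variable {p : ℕ} [hp : Fact p.Prime] {m : ℕ}

theorem continuous_redDir (k : ℕ) :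
    Continuous (redDir (PadicInt.toZModPow (p := p) k) m) := by
  have h : ∀ {α : Type} [TopologicalSpace α] (f : α → Fin m → ℤ_[p]), Continuous f →
      Continuous fun x i => PadicInt.toZModPow (p := p) k (f x i) := fun f hf =>
    (continuous_redPi p k (Fin m)).comp hf
  exact (((PadicInt.continuous_toZModPow k).comp (continuous_fst.comp continuous_fst)).prodMk
    (h _ (continuous_snd.comp continuous_fst))).prodMk (h _ continuous_snd)

/-- The points of `(ℤ / p ^ k) ^ (m + 2)` whose cosets lie in `V`. -/
def cosetFinset (V : Set (Fin (m + 2) → ℤ_[p])) (k : ℕ) :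
    Finset (ZMod (p ^ k) × ZMod (p ^ k) × (Fin m → ZMod (p ^ k))) := by
  classical
  exact Finset.univ.filter fun x => ∀ x', redPi p k _ x' = consPt x → x' ∈ V

theorem consPt_redHom_mem_cosetFinset (V : Set (Fin (m + 2) → ℤ_[p])) (k : ℕ)
    (x : ℤ_[p] × ℤ_[p] × (Fin m → ℤ_[p])) :
    redHom (PadicInt.toZModPow k) m x ∈ cosetFinset V k ↔ consPt x ∈ cosetInterior V k := by
  simp [cosetFinset, cosetInterior, redPi_consPt]

theorem padicHaar_cosetInterior (V : Set (Fin (m + 2) → ℤ_[p])) (k : ℕ) :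
    padicHaar p (m + 2) (cosetInterior V k) =
      ENNReal.ofReal ((cosetFinset V k).card / ((p : ℝ) ^ k) ^ (m + 2)) := by
  classical
  rw [← Finset.card_image_of_injective (cosetFinset V k) (consPt_bijective m).1,
    ← padicHaar_preimage_redPi]
  congr 1
  ext x
  obtain ⟨x, rfl⟩ := (consPt_bijective m).2 x
  rw [Set.mem_preimage, redPi_consPt, Finset.mem_coe,
    (consPt_bijective m).1.mem_finset_image, consPt_redHom_mem_cosetFinset]

theorem padicHaar_planePt_mem_cosetInterior (V : Set (Fin (m + 2) → ℤ_[p])) (k : ℕ)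
    (a : ℤ_[p] × ℤ_[p] × (Fin m → ℤ_[p])) (u : (ℤ_[p] × (Fin m → ℤ_[p])) × (Fin m → ℤ_[p])) :
    padicHaar p 2 {s | consPt (planePt a u (s 0) (s 1)) ∈ cosetInterior V k} =
      ENNReal.ofReal ((∑ s : ZMod (p ^ k), ∑ t : ZMod (p ^ k),
        if planePt (redHom (PadicInt.toZModPow k) m a) (redDir (PadicInt.toZModPow k) m u) s t ∈
          cosetFinset V k then (1 : ℝ) else 0) / ((p : ℝ) ^ k) ^ 2) := by
  classical
  have h := padicHaar_preimage_redPi p k 2 (Finset.univ.filter fun s : Fin 2 → ZMod (p ^ k) =>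
    planePt (redHom (PadicInt.toZModPow k) m a) (redDir (PadicInt.toZModPow k) m u) (s 0) (s 1) ∈
          cosetFinset V k)
  rw [Finset.card_filter, Nat.cast_sum, ← (finTwoArrowEquiv (ZMod (p ^ k))).symm.sum_comp,
    Fintype.sum_prod_type] at h
  simp only [Nat.cast_ite, Nat.cast_one, Nat.cast_zero, finTwoArrowEquiv_symm_apply,
    Matrix.cons_val_zero, Matrix.cons_val_one] at h
  rw [← h]
  congr 1
  ext s
  simp only [Set.mem_ofPred_eq, Finset.coe_filter, Finset.mem_univ, true_and, Set.mem_preimage,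
    redPi_apply]
  rw [← redHom_planePt, consPt_redHom_mem_cosetFinset]

/-- If an open set meets a translate of every plane substantially, then the same holds uniformly
at some finite level. -/
theorem exists_uniform_level {V : Set (Fin (m + 2) → ℤ_[p])} (hV : IsOpen V) {v w : ℝ}
    (hwv : w < v) (hv : 0 < v)
    (h : ∀ g ∈ grSet p (m + 2), ∃ a : Fin (m + 2) → ℤ_[p], ENNReal.ofReal v ≤
      padicHaar p 2 {s | (fun j => a j + s 0 * g 0 j + s 1 * g 1 j) ∈ V}) :
    ∃ k : ℕ, ∀ g, ∃ a, w * ((p : ℝ) ^ k) ^ 2 ≤ ∑ s : ZMod (p ^ k), ∑ t : ZMod (p ^ k),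
      if planePt a g s t ∈ cosetFinset V k then (1 : ℝ) else 0 := by
  have hp0 : (0 : ℝ) < p := by exact_mod_cast hp.out.pos
  let O' : ∀ k, Set ((ZMod (p ^ k) × (Fin m → ZMod (p ^ k))) × (Fin m → ZMod (p ^ k))) := fun k =>
    {g | ∃ a, ENNReal.ofReal w ≤ ENNReal.ofReal ((∑ s : ZMod (p ^ k), ∑ t : ZMod (p ^ k),
      if planePt a g s t ∈ cosetFinset V k then (1 : ℝ) else 0) / ((p : ℝ) ^ k) ^ 2)}
  let O : ℕ → Set ((ℤ_[p] × (Fin m → ℤ_[p])) × (Fin m → ℤ_[p])) := fun k =>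
    redDir (PadicInt.toZModPow k) m ⁻¹' O' k
  have hO : ∀ k u, u ∈ O k ↔ ∃ a, ENNReal.ofReal w ≤
      padicHaar p 2 {s | consPt (planePt a u (s 0) (s 1)) ∈ cosetInterior V k} := by
    intro k u
    simp only [padicHaar_planePt_mem_cosetInterior]
    exact (redHom_surjective (ZMod.ringHom_surjective (PadicInt.toZModPow k)) m).exists
  have hmono : Monotone O := by
    intro k l hkl u hu
    rw [hO] at hu ⊢
    obtain ⟨a, ha⟩ := hu
    exact ⟨a, ha.trans (measure_mono fun s hs => monotone_cosetInterior V hkl hs)⟩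
  have hcover : Set.univ ⊆ ⋃ k, O k := by
    rintro u -
    obtain ⟨a, ha⟩ := h ![consPt (1, u.1), consPt (0, 1, u.2)] ⟨0, 1, by simp [consPt]⟩
    obtain ⟨a, rfl⟩ := (consPt_bijective m).2 a
    simp only [Matrix.cons_val_zero, Matrix.cons_val_one, consPt_planePt] at ha
    have hunion : {s : Fin 2 → ℤ_[p] | consPt (planePt a u (s 0) (s 1)) ∈ V} =
        ⋃ k, {s | consPt (planePt a u (s 0) (s 1)) ∈ cosetInterior V k} := by
      ext s
      rw [Set.mem_iUnion, Set.mem_ofPred_eq]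
      nth_rw 1 [← iUnion_cosetInterior hV]
      exact Set.mem_iUnion
    have hm : Monotone fun k => {s : Fin 2 → ℤ_[p] |
        consPt (planePt a u (s 0) (s 1)) ∈ cosetInterior V k} :=
      fun k l hkl s hs => monotone_cosetInterior V hkl hs
    rw [hunion, hm.measure_iUnion] at ha
    obtain ⟨k, hk⟩ := lt_iSup_iff.1 (((ENNReal.ofReal_lt_ofReal_iff hv).2 hwv).trans_le ha)
    exact Set.mem_iUnion.2 ⟨k, (hO k u).2 ⟨a, hk.le⟩⟩
  obtain ⟨k, hk⟩ := isCompact_univ.elim_directed_cover O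
    (fun k => (isOpen_discrete (O' k)).preimage (continuous_redDir k)) hcover hmono.directed_le
  refine ⟨k, fun g => ?_⟩
  obtain ⟨u, rfl⟩ := redDir_surjective (ZMod.ringHom_surjective (PadicInt.toZModPow k)) m g
  obtain ⟨a, ha⟩ := hk (Set.mem_univ u)
  refine ⟨a, ?_⟩
  rw [ENNReal.ofReal_le_ofReal_iff (div_nonneg (Finset.sum_nonneg fun s _ =>
    Finset.sum_nonneg fun t _ => by split_ifs <;> norm_num) (by positivity)),
    le_div_iff₀ (by positivity)] at ha
  exact ha

end

theorem exists_ofReal_le_padicHaar (p : ℕ) [hp : Fact p.Prime] (m : ℕ) (hm : 1 ≤ m) :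
    ∃ C : ℝ, 0 < C ∧ ∀ S : Set (Fin (m + 2) → ℤ_[p]), ∀ v : ℝ, 0 < v → v ≤ 1 →
      (∀ g ∈ grSet p (m + 2), ∃ a : Fin (m + 2) → ℤ_[p], ENNReal.ofReal v ≤
        padicHaar p 2 {s | (fun j => a j + s 0 * g 0 j + s 1 * g 1 j) ∈ S}) →
      ENNReal.ofReal (C * v ^ (m + 1)) ≤ padicHaar p (m + 2) S := by
  obtain ⟨C, hC, hfin⟩ := exists_le_card_of_planes p m hm
  have hp0 : (0 : ℝ) < p := by exact_mod_cast hp.out.pos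
  refine ⟨C / 2 ^ (m + 1), by positivity, fun S v hv hv1 hS => ?_⟩
  rw [S.measure_eq_iInf_isOpen]
  refine le_iInf₂ fun V hSV => le_iInf fun hV => ?_
  obtain ⟨k, hk⟩ := exists_uniform_level hV (half_lt_self hv) hv fun g hg => by
    obtain ⟨a, ha⟩ := hS g hg
    exact ⟨a, ha.trans (measure_mono fun s hs => hSV hs)⟩
  have h1 := hfin k (cosetFinset V k) (v / 2) (half_pos hv) (by linarith) hk
  calc ENNReal.ofReal (C / 2 ^ (m + 1) * v ^ (m + 1))
      ≤ ENNReal.ofReal ((cosetFinset V k).card / ((p : ℝ) ^ k) ^ (m + 2)) := by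
        refine ENNReal.ofReal_le_ofReal ((le_div_iff₀ (by positivity)).2 ?_)
        rw [div_pow] at h1
        calc _ = _ := by ring
          _ ≤ _ := h1
    _ = padicHaar p (m + 2) (cosetInterior V k) := (padicHaar_cosetInterior V k).symm
    _ ≤ padicHaar p (m + 2) V := measure_mono (cosetInterior_subset V k)

theorem ofReal_le_padicHaar_two (p : ℕ) [hp : Fact p.Prime] (S : Set (Fin 2 → ℤ_[p])) (v : ℝ≥0∞)
    (hS : ∀ g ∈ grSet p 2, ∃ a : Fin 2 → ℤ_[p], v ≤
        padicHaar p 2 {s | (fun j => a j + s 0 * g 0 j + s 1 * g 1 j) ∈ S}) :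
    v ≤ padicHaar p 2 S := by
  obtain ⟨a, ha⟩ := hS ![![1, 0], ![0, 1]] ⟨0, 1, by simp⟩
  rw [← measure_preimage_add (padicHaar p 2) a S]
  refine ha.trans (measure_mono fun s hs => ?_)
  rw [Set.mem_ofPred_eq] at hs
  rw [Set.mem_preimage]
  convert hs using 1
  ext j
  fin_cases j <;> simp

theorem exists_ofReal_mul_pow_le_padicHaar (p : ℕ) [Fact p.Prime] (n : ℕ) (hn : 2 ≤ n) :
    ∃ C : ℝ, 0 < C ∧ ∀ S : Set (Fin n → ℤ_[p]), ∀ v : ℝ, 0 < v → v ≤ 1 →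
      (∀ g ∈ grSet p n, ∃ a : Fin n → ℤ_[p], ENNReal.ofReal v ≤
        padicHaar p 2 {s | (fun j => a j + s 0 * g 0 j + s 1 * g 1 j) ∈ S}) →
      ENNReal.ofReal (C * v ^ (n - 1)) ≤ padicHaar p n S := by
  obtain ⟨m, rfl⟩ := Nat.exists_eq_add_of_le' hn
  rcases Nat.eq_zero_or_pos m with rfl | hm
  · refine ⟨1, one_pos, fun S v _ _ hS => ?_⟩
    simpa using ofReal_le_padicHaar_two p S _ hS
  · exact exists_ofReal_le_padicHaar p m hm

/-- If `S ⊆ ℤ_p^n` is measurable and, for every 2-plane `U ∈ Gr(ℤ_p^n, 2)` (spanned by the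
rows of a matrix `g` with a unit `2 × 2` minor), some translate `a + U` meets `S` in
`μ_U`-measure at least `δ²`, then `μ(S) ≥ C_n δ^{2(n-1)}` with `C_n > 0` depending only on
`n` and `p`. In particular (`δ = 1`), a measurable set containing a translate of every
2-dimensional subspace of `ℤ_p^n` has positive Haar measure: `(n,2)`-Besicovitch sets do
not exist in `ℤ_p^n`. -/
theorem no_Besicovitch_2planes (p : ℕ) [Fact p.Prime] (n : ℕ) (hn : 2 ≤ n) :
    ∃ C : ℝ, 0 < C ∧
      (∀ S : Set (Fin n → ℤ_[p]), MeasurableSet S → ∀ δ : ℝ, 0 < δ → δ ≤ 1 →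
        (∀ g ∈ grSet p n, ∃ a : Fin n → ℤ_[p],
          ENNReal.ofReal (δ ^ 2) ≤ padicHaar p 2
            {s : Fin 2 → ℤ_[p] | (fun j => a j + s 0 * g 0 j + s 1 * g 1 j) ∈ S}) →
        ENNReal.ofReal (C * δ ^ (2 * (n - 1))) ≤ padicHaar p n S) ∧
      (∀ S : Set (Fin n → ℤ_[p]), MeasurableSet S →
        (∀ g ∈ grSet p n, ∃ a : Fin n → ℤ_[p], ∀ s : Fin 2 → ℤ_[p],
          (fun j => a j + s 0 * g 0 j + s 1 * g 1 j) ∈ S) →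
        0 < padicHaar p n S) := by
  obtain ⟨C, hC, h⟩ := exists_ofReal_mul_pow_le_padicHaar p n hn
  refine ⟨C, hC, fun S _ δ hδ hδ1 hS => ?_, fun S _ hS => ?_⟩
  · rw [pow_mul]
    exact h S (δ ^ 2) (by positivity) (pow_le_one₀ hδ.le hδ1) hS
  · refine lt_of_lt_of_le ?_ (h S 1 one_pos le_rfl fun g hg => ?_)
    · simpa using hC
    · obtain ⟨a, ha⟩ := hS g hg
      refine ⟨a, ?_⟩
      simp [ha]

end
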